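/- arXiv:2507.14033 — 2 statements merged into one kernel-verified Lean document; each statement's English description precedes it below -/
import Mathlib

section
/- Classification of lower Bruhat intervals in type A~2: for all u, v ∈ W, the lower Bruhat intervals [e,u] and [e,v] are isomorphic as posets if and only if v belongs to the G-orbit of u, i.e. v = g(u) for some g ∈ G. -/
noncomputable section

open scoped RealInnerProductSpace

/-- The Bruhat strict order on a Coxeter group: the transitive closure of the relation
"multiply on the left by a reflection, increasing the length". -/
def bruhatLT {B : Type*} {W : Type*} [Group W] {M : CoxeterMatrix B}
    (cs : CoxeterSystem M W) : W → W → Prop :=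
  Relation.TransGen (fun a b => (∃ t, cs.IsReflection t ∧ b = t * a) ∧ cs.length a < cs.length b)

/-- The Bruhat order on a Coxeter group. -/
def bruhatLE {B : Type*} {W : Type*} [Group W] {M : CoxeterMatrix B}
    (cs : CoxeterSystem M W) (x y : W) : Prop :=
  x = y ∨ bruhatLT cs x y

/-- The Bruhat interval `[x, y]` as a set. -/
def Iset {B : Type*} {W : Type*} [Group W] {M : CoxeterMatrix B}
    (cs : CoxeterSystem M W) (x y : W) : Set W :=
  {z | bruhatLE cs x z ∧ bruhatLE cs z y}

/-- The Bruhat covers `U(x)` of an element `x`. -/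
def Uset {B : Type*} {W : Type*} [Group W] {M : CoxeterMatrix B}
    (cs : CoxeterSystem M W) (x : W) : Set W :=
  {w | bruhatLT cs x w ∧ cs.length w = cs.length x + 1}

/-- The Bruhat cocovers `L(y)` of an element `y`. -/
def Lset {B : Type*} {W : Type*} [Group W] {M : CoxeterMatrix B}
    (cs : CoxeterSystem M W) (y : W) : Set W :=
  {w | bruhatLT cs w y ∧ cs.length y = cs.length w + 1}

/-- An interval `[x, y]` is full if it contains all Bruhat covers of `x` and all
Bruhat cocovers of `y`. -/
def FullInt {B : Type*} {W : Type*} [Group W] {M : CoxeterMatrix B}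
    (cs : CoxeterSystem M W) (x y : W) : Prop :=
  Uset cs x ⊆ Iset cs x y ∧ Lset cs y ⊆ Iset cs x y

/-- Two Bruhat intervals (possibly in different Coxeter groups) are isomorphic as posets. -/
def IntervalIso {B : Type*} {W : Type*} {B' : Type*} {W' : Type*} [Group W] [Group W']
    {M : CoxeterMatrix B} {M' : CoxeterMatrix B'}
    (cs : CoxeterSystem M W) (cs' : CoxeterSystem M' W') (x y : W) (x' y' : W') : Prop :=
  ∃ f : {z : W // bruhatLE cs x z ∧ bruhatLE cs z y} ≃
        {z : W' // bruhatLE cs' x' z ∧ bruhatLE cs' z y'},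
    ∀ u v, bruhatLE cs u.1 v.1 ↔ bruhatLE cs' (f u).1 (f v).1

/-- The group `G` of generic automorphisms: the subgroup of the permutation group of `W`
generated by the Dynkin diagram automorphisms `δ`, `σ` and inversion. -/
def Gsub {W : Type*} [Group W] (dl sg : W ≃* W) : Subgroup (Equiv.Perm W) :=
  Subgroup.closure {dl.toEquiv, sg.toEquiv, Equiv.inv W}

namespace AffineA2

/-- Alcoves of type `Ã₂`, recorded by the integer parts of their three affine coordinates. -/
abbrev Alcove := ℤ × ℤ × ℤ

/-- The reflection of alcoves in the hyperplane on which the `i`-th affine coordinate is `m`. -/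
def refl : Fin 3 → ℤ → Alcove → Alcove
  | 0, m, (x, y, z) => (2 * m - 1 - x, -z - m, -y - m)
  | 1, m, (x, y, z) => (-z - m, 2 * m - 1 - y, -x - m)
  | 2, m, (x, y, z) => (-y - m, -x - m, 2 * m - 1 - z)

/-- The `i`-th coordinate of an alcove. -/
def coord : Fin 3 → Alcove → ℤ
  | 0, a => a.1
  | 1, a => a.2.1
  | 2, a => a.2.2

/-- The number of hyperplanes separating an alcove from the fundamental one. -/
def len (a : Alcove) : ℕ := a.1.natAbs + a.2.1.natAbs + a.2.2.natAbs

/-- The largest absolute value of a coordinate. -/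
def maxAbs (a : Alcove) : ℕ := max a.1.natAbs (max a.2.1.natAbs a.2.2.natAbs)

/-- The smallest absolute value of a coordinate. -/
def minAbs (a : Alcove) : ℕ := min a.1.natAbs (min a.2.1.natAbs a.2.2.natAbs)

/-- The multiset of absolute values of the coordinates of an alcove, in numerical form. -/
def label (a : Alcove) : ℕ × ℕ × ℕ := (len a, maxAbs a, minAbs a)

/-- The condition satisfied by the coordinates of an actual alcove. -/
def IsAlcove (a : Alcove) : Prop := a.1 + a.2.1 + a.2.2 = 0 ∨ a.1 + a.2.1 + a.2.2 = -1

/-- The images of an alcove under reflections which lower the length by one. -/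
def coatoms (a : Alcove) : Set Alcove := {b | (∃ i m, b = refl i m a) ∧ len a = len b + 1}

theorem refl_refl (i : Fin 3) (m : ℤ) (a : Alcove) : refl i m (refl i m a) = a := by
  obtain ⟨x, y, z⟩ := a
  fin_cases i <;> simp [refl]

theorem isAlcove_refl (i : Fin 3) (m : ℤ) {a : Alcove} (h : IsAlcove a) :
    IsAlcove (refl i m a) := by
  obtain ⟨x, y, z⟩ := a
  fin_cases i <;> simp [refl, IsAlcove] at h ⊢ <;> omega

theorem len_refl_zero_of_neg {i : Fin 3} {a : Alcove} (ha : IsAlcove a) (h : coord i a < 0) :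
    len a = len (refl i 0 a) + 1 := by
  obtain ⟨x, y, z⟩ := a
  fin_cases i <;> simp [refl, coord, len, IsAlcove] at ha h ⊢ <;> omega

theorem coord_refl_zero_self (i : Fin 3) (a : Alcove) :
    coord i (refl i 0 a) = -1 - coord i a := by
  obtain ⟨x, y, z⟩ := a
  fin_cases i <;> simp [refl, coord]

/-- If two coordinates are negative, the third one is positive and the whole dihedral
orbit descends. -/
theorem coord_refl_zero_neg {i j : Fin 3} (hij : i ≠ j) {a : Alcove} (ha : IsAlcove a)
    (hi : coord i a < 0) (hj : coord j a < 0) : coord i (refl j 0 a) < 0 := by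
  obtain ⟨x, y, z⟩ := a
  fin_cases i <;> fin_cases j <;> simp [refl, coord, IsAlcove] at hij ha hi hj ⊢ <;> omega

theorem coord_refl_refl {i j : Fin 3} (hij : i ≠ j) (a : Alcove) :
    coord j (refl i 0 (refl j 0 a)) = coord i a := by
  obtain ⟨x, y, z⟩ := a
  fin_cases i <;> fin_cases j <;> simp [refl, coord] at hij ⊢

theorem refl_braid {i j : Fin 3} (hij : i ≠ j) (a : Alcove) :
    refl i 0 (refl j 0 (refl i 0 (refl j 0 (refl i 0 (refl j 0 a))))) = a := by
  obtain ⟨x, y, z⟩ := a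
  fin_cases i <;> fin_cases j <;> simp [refl] at hij ⊢

theorem refl_conj_self (i : Fin 3) (m : ℤ) (a : Alcove) :
    refl i 0 (refl i m (refl i 0 a)) = refl i (-m) a := by
  obtain ⟨x, y, z⟩ := a
  fin_cases i <;> simp [refl] <;> omega

theorem exists_refl_conj {i j : Fin 3} (hij : i ≠ j) (m : ℤ) :
    ∃ k, j ≠ k ∧ ∀ a, refl j 0 (refl i m (refl j 0 a)) = refl k (1 - m) a := by
  fin_cases i <;> fin_cases j <;> simp at hij
  · exact ⟨2, by decide, by rintro ⟨x, y, z⟩; simp [refl]; omega⟩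
  · exact ⟨1, by decide, by rintro ⟨x, y, z⟩; simp [refl]; omega⟩
  · exact ⟨2, by decide, by rintro ⟨x, y, z⟩; simp [refl]; omega⟩
  · exact ⟨0, by decide, by rintro ⟨x, y, z⟩; simp [refl]; omega⟩
  · exact ⟨1, by decide, by rintro ⟨x, y, z⟩; simp [refl]; omega⟩
  · exact ⟨0, by decide, by rintro ⟨x, y, z⟩; simp [refl]; omega⟩

section Coxeter

variable {W : Type*} [Group W] {M : CoxeterMatrix (Fin 3)} (cs : CoxeterSystem M W)

/-- The simple reflections, as elements of the monoid of self-maps. -/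
def simpleEnd (i : Fin 3) : Function.End Alcove := refl i 0

theorem isLiftable_simpleEnd (hM : ∀ i j : Fin 3, M i j = if i = j then 1 else 3) :
    M.IsLiftable simpleEnd := by
  intro i j
  rw [hM]
  split_ifs with h
  · subst h
    funext a
    exact refl_refl i 0 a
  · funext a
    exact refl_braid h a

/-- The action of the Coxeter group on alcoves. -/
def act (hM : ∀ i j : Fin 3, M i j = if i = j then 1 else 3) : W →* Function.End Alcove :=
  cs.lift ⟨simpleEnd, isLiftable_simpleEnd hM⟩

/-- The alcove corresponding to an element of the Coxeter group. -/
def alc (hM : ∀ i j : Fin 3, M i j = if i = j then 1 else 3) (w : W) : Alcove :=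
  act cs hM w (0, 0, 0)

variable (hM : ∀ i j : Fin 3, M i j = if i = j then 1 else 3)

theorem act_simple (i : Fin 3) (a : Alcove) : act cs hM (cs.simple i) a = refl i 0 a := by
  rw [act, cs.lift_apply_simple]
  rfl

theorem act_mul (x y : W) (a : Alcove) : act cs hM (x * y) a = act cs hM x (act cs hM y a) := by
  rw [map_mul]
  rfl

theorem act_one (a : Alcove) : act cs hM 1 a = a := by
  rw [map_one]
  rfl

theorem alc_mul (x y : W) : alc cs hM (x * y) = act cs hM x (alc cs hM y) := act_mul cs hM x y _

theorem alc_one : alc cs hM 1 = (0, 0, 0) := act_one cs hM _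

theorem alc_simple_mul (i : Fin 3) (x : W) :
    alc cs hM (cs.simple i * x) = refl i 0 (alc cs hM x) := by
  rw [alc_mul cs hM, act_simple cs hM]

theorem isAlcove_alc (x : W) : IsAlcove (alc cs hM x) := by
  induction x using cs.simple_induction_left with
  | one => rw [alc_one cs hM]; left; rfl
  | mul_simple_left x i ih => rw [alc_simple_mul cs hM]; exact isAlcove_refl i 0 ih

theorem simple_braid (hM : ∀ i j : Fin 3, M i j = if i = j then 1 else 3)
    {i j : Fin 3} (hij : i ≠ j) :
    cs.simple i * cs.simple j * cs.simple i = cs.simple j * cs.simple i * cs.simple j := by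
  have h := cs.simple_mul_simple_pow i j
  rw [hM, if_neg hij] at h
  have h2 : (cs.simple i * cs.simple j * cs.simple i) * (cs.simple j * cs.simple i * cs.simple j)
      = 1 := by
    rw [← h]
    simp only [pow_succ, pow_zero, one_mul, mul_assoc]
  rw [mul_eq_one_iff_eq_inv] at h2
  rw [h2]
  simp [mul_assoc]

theorem length_simple_mul_of_coord_neg (x : W) (i : Fin 3) (h : coord i (alc cs hM x) < 0) :
    cs.length (cs.simple i * x) < cs.length x := by
  induction hn : cs.length x using Nat.strong_induction_on generalizing x i with
  | _ n ih =>
  by_cases hx : x = 1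
  · subst hx
    rw [alc_one cs hM] at h
    fin_cases i <;> simp [coord] at h
  obtain ⟨j, hj⟩ := cs.exists_leftDescent_of_ne_one hx
  rw [cs.isLeftDescent_iff] at hj
  have key := alc_simple_mul cs hM j x
  have hja : coord j (alc cs hM x) < 0 := by
    by_contra hc
    have := ih _ (by omega) (cs.simple j * x) j
      (by rw [key, coord_refl_zero_self]; omega) rfl
    rw [cs.simple_mul_simple_cancel_left] at this
    omega
  by_cases hij : i = j
  · subst hij; omega
  have h1 := ih _ (by omega) (cs.simple j * x) i
    (by rw [key]; exact coord_refl_zero_neg hij (isAlcove_alc cs hM x) h hja) rfl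
  have h2 := ih _ (by omega) (cs.simple i * (cs.simple j * x)) j
    (by rw [alc_simple_mul cs hM, key, coord_refl_refl hij]; exact h) rfl
  have e : cs.simple i * x
      = cs.simple j * cs.simple i * (cs.simple j * (cs.simple i * (cs.simple j * x))) := by
    have hb := simple_braid cs hM hij
    have : cs.simple j * cs.simple i * (cs.simple j * (cs.simple i * (cs.simple j * x)))
      = cs.simple j * (cs.simple i * cs.simple j * cs.simple i) * cs.simple j * x := by group
    rw [this, hb]
    simp [mul_assoc]
  have h3 := cs.length_mul_le (cs.simple j * cs.simple i)
    (cs.simple j * (cs.simple i * (cs.simple j * x)))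
  have h4 := cs.length_mul_le (cs.simple j) (cs.simple i)
  rw [cs.length_simple, cs.length_simple] at h4
  rw [← e] at h3
  omega

theorem coord_neg_of_isLeftDescent {x : W} {i : Fin 3} (h : cs.IsLeftDescent x i) :
    coord i (alc cs hM x) < 0 := by
  by_contra hc
  have := length_simple_mul_of_coord_neg cs hM (cs.simple i * x) i
    (by rw [alc_simple_mul cs hM, coord_refl_zero_self]; omega)
  rw [cs.simple_mul_simple_cancel_left] at this
  exact lt_asymm this h

theorem len_alc (x : W) : len (alc cs hM x) = cs.length x := by
  induction hn : cs.length x using Nat.strong_induction_on generalizing x with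
  | _ n ih =>
  by_cases hx : x = 1
  · subst hx
    rw [alc_one cs hM, ← hn, cs.length_one]
    rfl
  obtain ⟨j, hj⟩ := cs.exists_leftDescent_of_ne_one hx
  have h := len_refl_zero_of_neg (isAlcove_alc cs hM x) (coord_neg_of_isLeftDescent cs hM hj)
  rw [cs.isLeftDescent_iff] at hj
  rw [h, ← alc_simple_mul cs hM, ih _ (by omega) _ rfl]
  omega

theorem alc_injective : Function.Injective (alc cs hM) := by
  intro x y h
  have h1 : alc cs hM (y⁻¹ * x) = (0, 0, 0) := by
    rw [alc_mul cs hM, h, ← alc_mul cs hM, inv_mul_cancel, alc_one cs hM]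
  have h2 := len_alc cs hM (y⁻¹ * x)
  rw [h1] at h2
  have h3 : y⁻¹ * x = 1 := cs.length_eq_zero_iff.mp h2.symm
  exact (inv_mul_eq_one.mp h3).symm

theorem exists_act_eq_refl {t : W} (ht : cs.IsReflection t) :
    ∃ i m, ∀ a, act cs hM t a = refl i m a := by
  obtain ⟨w, i, rfl⟩ := ht
  induction w using cs.simple_induction_left with
  | one => exact ⟨i, 0, by simp [act_simple cs hM]⟩
  | mul_simple_left w j ih =>
    obtain ⟨k, m, h⟩ := ih
    have e : ∀ a, act cs hM (cs.simple j * w * cs.simple i * (cs.simple j * w)⁻¹) a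
        = refl j 0 (refl k m (refl j 0 a)) := by
      intro a
      rw [show cs.simple j * w * cs.simple i * (cs.simple j * w)⁻¹
        = cs.simple j * ((w * cs.simple i * w⁻¹) * cs.simple j) by simp [mul_assoc],
        act_mul cs hM, act_mul cs hM, h, act_simple cs hM, act_simple cs hM]
    by_cases hkj : k = j
    · subst hkj
      exact ⟨k, -m, fun a => by rw [e, refl_conj_self]⟩
    · obtain ⟨l, -, hl⟩ := exists_refl_conj hkj m
      exact ⟨l, 1 - m, fun a => by rw [e, hl]⟩

theorem exists_isReflection_conj {i : Fin 3} {m : ℤ} (j : Fin 3)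
    (h : ∃ t, cs.IsReflection t ∧ ∀ a, act cs hM t a = refl i m a) :
    ∃ t, cs.IsReflection t ∧ ∀ a, act cs hM t a = refl j 0 (refl i m (refl j 0 a)) := by
  obtain ⟨t, ht, h⟩ := h
  refine ⟨_, ht.conj (cs.simple j), fun a => ?_⟩
  rw [act_mul cs hM, act_mul cs hM, cs.inv_simple, act_simple cs hM, act_simple cs hM, h]

theorem exists_isReflection_succ {m : ℤ}
    (h : ∀ i, ∃ t, cs.IsReflection t ∧ ∀ a, act cs hM t a = refl i (-m) a) (i : Fin 3) :
    ∃ t, cs.IsReflection t ∧ ∀ a, act cs hM t a = refl i (m + 1) a := by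
  obtain ⟨j, hj⟩ : ∃ j : Fin 3, j ≠ i := exists_ne i
  obtain ⟨k, -, e⟩ := exists_refl_conj hj.symm (m + 1)
  have h2 := exists_isReflection_conj cs hM j (h k)
  rw [show -m = 1 - (m + 1) by ring] at h2
  simpa only [← e, refl_refl] using h2

theorem exists_isReflection_act_eq (m : ℤ) :
    ∀ i, ∃ t, cs.IsReflection t ∧ ∀ a, act cs hM t a = refl i m a := by
  induction m using Int.induction_on with
  | zero => exact fun i => ⟨cs.simple i, cs.isReflection_simple i, act_simple cs hM i⟩
  | succ n ih =>
    intro i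
    refine exists_isReflection_succ cs hM (fun k => ?_) i
    have h := exists_isReflection_conj cs hM k (ih k)
    simpa only [refl_conj_self] using h
  | pred n ih =>
    intro i
    have h := exists_isReflection_conj cs hM i (exists_isReflection_succ cs hM ih i)
    simp only [refl_conj_self] at h
    rwa [neg_add'] at h

end Coxeter

theorem eq_zero_or_one_or_two (i : Fin 3) : i = 0 ∨ i = 1 ∨ i = 2 := by
  revert i
  decide

theorem refl_mem_coatoms {a : Alcove} {i : Fin 3} {m : ℤ} (h : len a = len (refl i m a) + 1) :
    refl i m a ∈ coatoms a := ⟨⟨i, m, rfl⟩, h⟩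

/-- Representatives of the alcoves of even length. -/
def evenRep (p q : ℤ) : Alcove := (p + q, -p, -q)

/-- Representatives of the alcoves of odd length with two negative coordinates. -/
def posRep (p q : ℤ) : Alcove := (p + q - 1, -p, -q)

/-- Representatives of the alcoves of odd length with a unique negative coordinate. -/
def negRep (p q : ℤ) : Alcove := (-(p + q + 1), p, q)

/-- Chosen representatives of the orbits of alcoves. -/
def IsRep (a : Alcove) : Prop :=
  ∃ p q, q ≤ p ∧ ((0 ≤ q ∧ a = evenRep p q) ∨ (1 ≤ q ∧ a = posRep p q) ∨ (0 ≤ q ∧ a = negRep p q))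

theorem len_evenRep {p q : ℤ} (hq : 0 ≤ q) (hp : q ≤ p) :
    (len (evenRep p q) : ℤ) = 2 * (p + q) := by
  simp only [len, evenRep]
  omega

theorem len_posRep {p q : ℤ} (hq : 1 ≤ q) (hp : q ≤ p) :
    (len (posRep p q) : ℤ) = 2 * (p + q) - 1 := by
  simp only [len, posRep]
  omega

theorem len_negRep {p q : ℤ} (hq : 0 ≤ q) (hp : q ≤ p) :
    (len (negRep p q) : ℤ) = 2 * (p + q) + 1 := by
  simp only [len, negRep]
  omega

theorem minAbs_evenRep {p q : ℤ} (hq : 0 ≤ q) (hp : q ≤ p) : (minAbs (evenRep p q) : ℤ) = q := by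
  simp only [minAbs, evenRep]
  omega

theorem minAbs_posRep {p q : ℤ} (hq : 1 ≤ q) (hp : q ≤ p) : (minAbs (posRep p q) : ℤ) = q := by
  simp only [minAbs, posRep]
  omega

theorem minAbs_negRep {p q : ℤ} (hq : 0 ≤ q) (hp : q ≤ p) : (minAbs (negRep p q) : ℤ) = q := by
  simp only [minAbs, negRep]
  omega

theorem maxAbs_evenRep {p q : ℤ} (hq : 0 ≤ q) (hp : q ≤ p) :
    (maxAbs (evenRep p q) : ℤ) = p + q := by
  simp only [maxAbs, evenRep]
  omega

theorem maxAbs_posRep {p q : ℤ} (hq : 1 ≤ q) (hp : q ≤ p) :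
    (maxAbs (posRep p q) : ℤ) = p + q - 1 := by
  simp only [maxAbs, posRep]
  omega

theorem maxAbs_negRep {p q : ℤ} (hq : 0 ≤ q) (hp : q ≤ p) :
    (maxAbs (negRep p q) : ℤ) = p + q + 1 := by
  simp only [maxAbs, negRep]
  omega

theorem eq_of_label_eq {a b : Alcove} (ha : IsRep a) (hb : IsRep b) (h : label a = label b) :
    a = b := by
  simp only [label, Prod.mk.injEq] at h
  have key : ∀ {a : Alcove}, IsRep a → ∃ p q : ℤ, (len a = 2 * (p + q) ∧ maxAbs a = p + q ∧
      minAbs a = q ∧ a = evenRep p q) ∨ (len a = 2 * (p + q) - 1 ∧ maxAbs a = p + q - 1 ∧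
      minAbs a = q ∧ a = posRep p q) ∨ (len a = 2 * (p + q) + 1 ∧ maxAbs a = p + q + 1 ∧
      minAbs a = q ∧ a = negRep p q) := by
    rintro a ⟨p, q, hp, ⟨hq, rfl⟩ | ⟨hq, rfl⟩ | ⟨hq, rfl⟩⟩
    · exact ⟨p, q, .inl ⟨len_evenRep hq hp, maxAbs_evenRep hq hp, minAbs_evenRep hq hp, rfl⟩⟩
    · exact ⟨p, q, .inr (.inl ⟨len_posRep hq hp, maxAbs_posRep hq hp, minAbs_posRep hq hp, rfl⟩)⟩
    · exact ⟨p, q, .inr (.inr ⟨len_negRep hq hp, maxAbs_negRep hq hp, minAbs_negRep hq hp, rfl⟩)⟩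
  obtain ⟨p, q, h1⟩ := key ha
  obtain ⟨p', q', h2⟩ := key hb
  rcases h1 with ⟨l, M, n, e⟩ | ⟨l, M, n, e⟩ | ⟨l, M, n, e⟩ <;>
  rcases h2 with ⟨l', M', n', e'⟩ | ⟨l', M', n', e'⟩ | ⟨l', M', n', e'⟩ <;>
  first
  | omega
  | rw [e, e', show q = q' by omega, show p = p' by omega]

theorem le_minAbs_of_mem_coatoms_evenRep {p q : ℤ} (hq : 0 ≤ q) (hp : q ≤ p) {b : Alcove}
    (hb : b ∈ coatoms (evenRep p q)) : q ≤ minAbs b + 1 := by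
  obtain ⟨⟨i, m, rfl⟩, h⟩ := hb
  have hl := len_evenRep hq hp
  rw [h] at hl
  clear h
  rcases eq_zero_or_one_or_two i with rfl | rfl | rfl <;>
  simp only [refl, len, minAbs, evenRep] at hl ⊢ <;> omega

theorem le_minAbs_of_mem_coatoms_posRep {p q : ℤ} (hq : 1 ≤ q) (hp : q ≤ p) {b : Alcove}
    (hb : b ∈ coatoms (posRep p q)) : q ≤ minAbs b + 1 := by
  obtain ⟨⟨i, m, rfl⟩, h⟩ := hb
  have hl := len_posRep hq hp
  rw [h] at hl
  clear h
  rcases eq_zero_or_one_or_two i with rfl | rfl | rfl <;>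
  simp only [refl, len, minAbs, posRep] at hl ⊢ <;> omega

theorem le_minAbs_of_mem_coatoms_negRep {p q : ℤ} (hq : 0 ≤ q) (hp : q ≤ p) {b : Alcove}
    (hb : b ∈ coatoms (negRep p q)) : q ≤ minAbs b + 1 := by
  obtain ⟨⟨i, m, rfl⟩, h⟩ := hb
  have hl := len_negRep hq hp
  rw [h] at hl
  clear h
  rcases eq_zero_or_one_or_two i with rfl | rfl | rfl <;>
  simp only [refl, len, minAbs, negRep] at hl ⊢ <;> omega

theorem minAbs_le_of_mem_coatoms {a b : Alcove} (ha : IsRep a) (hb : b ∈ coatoms a) :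
    minAbs a ≤ minAbs b + 1 := by
  obtain ⟨p, q, hp, ⟨hq, rfl⟩ | ⟨hq, rfl⟩ | ⟨hq, rfl⟩⟩ := ha
  · have h1 := le_minAbs_of_mem_coatoms_evenRep hq hp hb
    have h2 := minAbs_evenRep hq hp
    omega
  · have h1 := le_minAbs_of_mem_coatoms_posRep hq hp hb
    have h2 := minAbs_posRep hq hp
    omega
  · have h1 := le_minAbs_of_mem_coatoms_negRep hq hp hb
    have h2 := minAbs_negRep hq hp
    omega

theorem exists_mem_coatoms_minAbs {a : Alcove} (ha : IsRep a) (h : 0 < len a) :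
    ∃ b ∈ coatoms a, minAbs b = minAbs a - 1 := by
  obtain ⟨p, q, hq, ⟨h0, rfl⟩ | ⟨h0, rfl⟩ | ⟨h0, rfl⟩⟩ := ha
  · rcases h0.eq_or_lt with rfl | h1
    · refine ⟨_, refl_mem_coatoms (i := 1) (m := 0) ?_, ?_⟩ <;>
      simp only [refl, len, minAbs, evenRep] at h ⊢ <;> omega
    · refine ⟨_, refl_mem_coatoms (i := 2) (m := 0) ?_, ?_⟩ <;>
      simp only [refl, len, minAbs, evenRep] at h ⊢ <;> omega
  · refine ⟨_, refl_mem_coatoms (i := 2) (m := 0) ?_, ?_⟩ <;>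
    simp only [refl, len, minAbs, posRep] at h ⊢ <;> omega
  · rcases h0.eq_or_lt with rfl | h1
    · refine ⟨_, refl_mem_coatoms (i := 0) (m := 0) ?_, ?_⟩ <;>
      simp only [refl, len, minAbs, negRep] at h ⊢ <;> omega
    · refine ⟨_, refl_mem_coatoms (i := 2) (m := 1) ?_, ?_⟩ <;>
      simp only [refl, len, minAbs, negRep] at h ⊢ <;> omega

theorem ncard_coatoms_posRep {p q : ℤ} (hq : 1 ≤ q) (hp : q ≤ p) :
    (coatoms (posRep p q)).ncard ≤ if q = 1 then 3 else 4 := by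
  have key : coatoms (posRep p q) ⊆ ((if q = 1 then {refl 1 (1 - p) (posRep p q),
      refl 1 0 (posRep p q), refl 2 0 (posRep p q)} else {refl 1 (1 - p) (posRep p q),
      refl 1 0 (posRep p q), refl 2 (1 - q) (posRep p q), refl 2 0 (posRep p q)} :
        Finset Alcove) : Set Alcove) := by
    rintro _ ⟨⟨i, m, rfl⟩, h⟩
    have : (i = 1 ∧ (m = 1 - p ∨ m = 0)) ∨ (i = 2 ∧ (m = 1 - q ∨ m = 0)) := by
      fin_cases i <;> simp [refl, len, posRep] at h ⊢ <;> omega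
    rcases this with ⟨rfl, rfl | rfl⟩ | ⟨rfl, rfl | rfl⟩ <;> split_ifs with hh <;> simp [hh]
  refine (Set.ncard_le_ncard key (Finset.finite_toSet _)).trans ?_
  rw [Set.ncard_coe_finset]
  split_ifs
  · exact Finset.card_le_three
  · exact Finset.card_le_four

theorem ncard_coatoms_posRep_one_one : (coatoms (posRep 1 1)).ncard ≤ 2 := by
  have key : coatoms (posRep 1 1) ⊆
      (({refl 1 0 (posRep 1 1), refl 2 0 (posRep 1 1)} : Finset Alcove) : Set Alcove) := by
    rintro _ ⟨⟨i, m, rfl⟩, h⟩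
    have : (i = 1 ∧ m = 0) ∨ (i = 2 ∧ m = 0) := by
      fin_cases i <;> simp [refl, len, posRep] at h ⊢ <;> omega
    rcases this with ⟨rfl, rfl⟩ | ⟨rfl, rfl⟩ <;> simp
  refine (Set.ncard_le_ncard key (Finset.finite_toSet _)).trans ?_
  rw [Set.ncard_coe_finset]
  exact Finset.card_le_two

theorem finite_coatoms (a : Alcove) : (coatoms a).Finite := by
  refine ((Set.Finite.prod (Set.finite_Icc (-(len a : ℤ)) (len a)) (Set.Finite.prod
    (Set.finite_Icc (-(len a : ℤ)) (len a)) (Set.finite_Icc (-(len a : ℤ)) (len a))))).subset ?_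
  rintro ⟨x, y, z⟩ ⟨-, h⟩
  have hx : len (x, y, z) = x.natAbs + y.natAbs + z.natAbs := rfl
  simp only [Set.mem_prod, Set.mem_Icc]
  omega

theorem length_le_ncard_coatoms {a : Alcove} (l : List Alcove) (hl : l.Nodup)
    (h : ∀ b ∈ l, b ∈ coatoms a) : l.length ≤ (coatoms a).ncard := by
  rw [← List.toFinset_card_of_nodup hl, ← Set.ncard_coe_finset]
  exact Set.ncard_le_ncard (fun b hb => h b (by simpa using hb)) (finite_coatoms a)

theorem le_ncard_coatoms_negRep {p q : ℤ} (hq : 1 ≤ q) (hp : q ≤ p) :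
    (if p = 1 then 4 else 5) ≤ (coatoms (negRep p q)).ncard := by
  split_ifs with h
  · subst h
    obtain rfl : q = 1 := by omega
    refine length_le_ncard_coatoms [refl 0 (-2) (negRep 1 1), refl 0 0 (negRep 1 1),
      refl 1 1 (negRep 1 1), refl 2 1 (negRep 1 1)] (by decide) ?_
    simp only [List.forall_mem_cons]
    refine ⟨refl_mem_coatoms ?_, refl_mem_coatoms ?_, refl_mem_coatoms ?_, refl_mem_coatoms ?_,
      by simp⟩ <;> decide
  · refine length_le_ncard_coatoms [refl 0 (-(p + q)) (negRep p q), refl 0 0 (negRep p q),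
      refl 1 1 (negRep p q), refl 1 p (negRep p q), refl 2 1 (negRep p q)] ?_ ?_
    · simp [refl, negRep]
      omega
    · simp only [List.forall_mem_cons]
      refine ⟨refl_mem_coatoms ?_, refl_mem_coatoms ?_, refl_mem_coatoms ?_, refl_mem_coatoms ?_,
        refl_mem_coatoms ?_, by simp⟩ <;> simp [refl, negRep, len] <;> omega

theorem le_ncard_coatoms_negRep_zero {p : ℤ} (hp : 1 ≤ p) :
    (if p = 1 then 3 else 4) ≤ (coatoms (negRep p 0)).ncard := by
  split_ifs with h
  · subst h
    refine length_le_ncard_coatoms [refl 0 (-1) (negRep 1 0), refl 0 0 (negRep 1 0),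
      refl 1 1 (negRep 1 0)] (by decide) ?_
    simp only [List.forall_mem_cons]
    refine ⟨refl_mem_coatoms ?_, refl_mem_coatoms ?_, refl_mem_coatoms ?_, by simp⟩ <;> decide
  · refine length_le_ncard_coatoms [refl 0 (-p) (negRep p 0), refl 0 0 (negRep p 0),
      refl 1 1 (negRep p 0), refl 1 p (negRep p 0)] ?_ ?_
    · simp [refl, negRep]
      omega
    · simp only [List.forall_mem_cons]
      refine ⟨refl_mem_coatoms ?_, refl_mem_coatoms ?_, refl_mem_coatoms ?_, refl_mem_coatoms ?_,
        by simp⟩ <;> simp [refl, negRep, len] <;> omega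

theorem ncard_coatoms_negRep_zero {p : ℤ} (hp : 2 ≤ p) :
    (coatoms (negRep p 0)).ncard ≤ 4 := by
  have key : coatoms (negRep p 0) ⊆ (({refl 0 (-p) (negRep p 0), refl 0 0 (negRep p 0),
      refl 1 1 (negRep p 0), refl 1 p (negRep p 0)} : Finset Alcove) : Set Alcove) := by
    rintro _ ⟨⟨i, m, rfl⟩, h⟩
    have : (i = 0 ∧ (m = -p ∨ m = 0)) ∨ (i = 1 ∧ (m = 1 ∨ m = p)) := by
      fin_cases i <;> simp [refl, len, negRep] at h ⊢ <;> omega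
    rcases this with ⟨rfl, rfl | rfl⟩ | ⟨rfl, rfl | rfl⟩ <;> simp
  refine (Set.ncard_le_ncard key (Finset.finite_toSet _)).trans ?_
  rw [Set.ncard_coe_finset]
  exact Finset.card_le_four

theorem ncard_coatoms_evenRep_one_one : (coatoms (evenRep 1 1)).ncard ≤ 3 := by
  have key : coatoms (evenRep 1 1) ⊆ (({refl 0 2 (evenRep 1 1), refl 1 0 (evenRep 1 1),
      refl 2 0 (evenRep 1 1)} : Finset Alcove) : Set Alcove) := by
    rintro _ ⟨⟨i, m, rfl⟩, h⟩
    have : (i = 0 ∧ m = 2) ∨ (i = 1 ∧ m = 0) ∨ (i = 2 ∧ m = 0) := by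
      fin_cases i <;> simp [refl, len, evenRep] at h ⊢ <;> omega
    rcases this with ⟨rfl, rfl⟩ | ⟨rfl, rfl⟩ | ⟨rfl, rfl⟩ <;> simp
  refine (Set.ncard_le_ncard key (Finset.finite_toSet _)).trans ?_
  rw [Set.ncard_coe_finset]
  exact Finset.card_le_three

theorem le_ncard_coatoms_evenRep_two_zero : 4 ≤ (coatoms (evenRep 2 0)).ncard := by
  refine length_le_ncard_coatoms [refl 0 1 (evenRep 2 0), refl 0 2 (evenRep 2 0),
    refl 1 (-1) (evenRep 2 0), refl 1 0 (evenRep 2 0)] (by decide) ?_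
  simp only [List.forall_mem_cons]
  refine ⟨refl_mem_coatoms ?_, refl_mem_coatoms ?_, refl_mem_coatoms ?_, refl_mem_coatoms ?_,
    by simp⟩ <;> decide

theorem exists_mem_coatoms_evenRep_one {p : ℤ} (hp : 2 ≤ p) :
    ∃ b ∈ coatoms (evenRep p 1), maxAbs b = (p + 1).natAbs ∧ minAbs b = 1 := by
  refine ⟨_, refl_mem_coatoms (i := 1) (m := 0) ?_, ?_⟩ <;>
  simp only [refl, len, maxAbs, minAbs, evenRep] <;> omega

theorem minAbs_of_mem_coatoms_evenRep_zero {p : ℤ} (hp : 1 ≤ p) {b : Alcove}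
    (hb : b ∈ coatoms (evenRep p 0)) (h : maxAbs b = p.natAbs) : minAbs b = 0 := by
  obtain ⟨⟨i, m, rfl⟩, h'⟩ := hb
  have : (i = 0 ∧ (m = 1 ∨ m = p)) ∨ (i = 1 ∧ (m = 0 ∨ m = 1 - p)) := by
    fin_cases i <;> simp [refl, len, evenRep] at h' ⊢ <;> omega
  clear h'
  rcases this with ⟨rfl, rfl | rfl⟩ | ⟨rfl, rfl | rfl⟩ <;>
  simp only [refl, maxAbs, minAbs, evenRep] at h ⊢ <;> omega

/-- There are two coatoms with labels `{2, 1, 1}` lying over a common coatom with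
label `{1, 1, 1}`. -/
def HasDiamond (a : Alcove) : Prop :=
  ∃ b ∈ coatoms a, ∃ c ∈ coatoms a, b ≠ c ∧ label b = (4, 2, 1) ∧ label c = (4, 2, 1) ∧
    ∃ d ∈ coatoms b, d ∈ coatoms c ∧ label d = (3, 1, 1)

theorem hasDiamond_negRep_one_one : HasDiamond (negRep 1 1) :=
  ⟨(-2, 1, 1), ⟨⟨0, -2, by decide⟩, by decide⟩, (2, -1, -1), ⟨⟨0, 0, by decide⟩, by decide⟩,
    by decide, by decide, by decide, (1, -1, -1), ⟨⟨0, 0, by decide⟩, by decide⟩,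
    ⟨⟨0, 2, by decide⟩, by decide⟩, by decide⟩

theorem not_hasDiamond_negRep_two_zero : ¬ HasDiamond (negRep 2 0) := by
  have key : ∀ b ∈ coatoms (negRep 2 0), label b = (4, 2, 1) →
      b = (-1, -1, 2) ∨ b = (-2, 1, 1) := by
    rintro _ ⟨⟨i, m, rfl⟩, h⟩ h'
    fin_cases i <;> simp [refl, len, negRep, label, maxAbs, minAbs] at h h' ⊢ <;> omega
  have key1 : ∀ b ∈ coatoms (-1, -1, 2), label b = (3, 1, 1) → b = (-1, -1, 1) := by
    rintro _ ⟨⟨i, m, rfl⟩, h⟩ h'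
    fin_cases i <;> simp [refl, len, label, maxAbs, minAbs] at h h' ⊢ <;> omega
  have key2 : ∀ b ∈ coatoms (-2, 1, 1), label b = (3, 1, 1) → b = (1, -1, -1) := by
    rintro _ ⟨⟨i, m, rfl⟩, h⟩ h'
    fin_cases i <;> simp [refl, len, label, maxAbs, minAbs] at h h' ⊢ <;> omega
  rintro ⟨b, hb, c, hc, hbc, lb, lc, d, hdb, hdc, ld⟩
  rcases key b hb lb with rfl | rfl <;> rcases key c hc lc with rfl | rfl
  · exact hbc rfl
  · exact absurd ((key1 d hdb ld).symm.trans (key2 d hdc ld)) (by decide)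
  · exact absurd ((key1 d hdc ld).symm.trans (key2 d hdb ld)) (by decide)
  · exact hbc rfl

/-- The combinatorial data of the top of a lower interval which determine it. -/
structure SameTop (a b : Alcove) : Prop where
  len_eq : len a = len b
  ncard_eq : (coatoms a).ncard = (coatoms b).ncard
  label_subset : ∀ c ∈ coatoms a, ∃ d ∈ coatoms b, label d = label c
  diamond : HasDiamond a → HasDiamond b

theorem minAbs_le_of_sameTop {a b : Alcove} (ha : IsRep a) (hb : IsRep b) (h : SameTop a b)
    (hpos : 0 < len a) : minAbs b ≤ minAbs a - 1 + 1 := by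
  obtain ⟨c, hc, h1⟩ := exists_mem_coatoms_minAbs ha hpos
  obtain ⟨d, hd, h2⟩ := h.label_subset c hc
  have h3 := minAbs_le_of_mem_coatoms hb hd
  simp only [label, Prod.mk.injEq] at h2
  omega

theorem not_sameTop_evenRep {p p' : ℤ} (hp : 1 ≤ p) (h : SameTop (evenRep p 1) (evenRep p' 0))
    (h' : 0 ≤ p') : False := by
  have h1 : p' = p + 1 := by
    have := h.len_eq
    simp only [len, evenRep] at this
    omega
  subst h1
  rcases hp.eq_or_lt with rfl | hp
  · have h2 := ncard_coatoms_evenRep_one_one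
    have h3 := le_ncard_coatoms_evenRep_two_zero
    have := h.ncard_eq
    norm_num at this
    omega
  · obtain ⟨c, hc, h1, h2⟩ := exists_mem_coatoms_evenRep_one (p := p) (by omega)
    obtain ⟨d, hd, h3⟩ := h.label_subset c hc
    simp only [label, Prod.mk.injEq] at h3
    have := minAbs_of_mem_coatoms_evenRep_zero (by omega) hd (by omega)
    omega

theorem not_sameTop_negRep_posRep {p q p' q' : ℤ} (hq : 0 ≤ q) (hp : q ≤ p) (hq' : 1 ≤ q')
    (hp' : q' ≤ p') (h : SameTop (negRep p q) (posRep p' q')) (hqq : q ≤ q') (hqq' : q' ≤ q + 1)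
    (h0 : 1 ≤ q → q = q') : False := by
  have h1 : p' + q' = p + q + 1 := by
    have := h.len_eq
    simp only [len, negRep, posRep] at this
    omega
  have h2 := ncard_coatoms_posRep hq' hp'
  have h3 := h.ncard_eq
  rcases hq.eq_or_lt with rfl | hq
  · have h4 := le_ncard_coatoms_negRep_zero (p := p) (by omega)
    obtain rfl : q' = 1 := by omega
    rw [if_pos rfl] at h2
    split_ifs at h4 with h5
    · subst h5
      obtain rfl : p' = 1 := by omega
      have := ncard_coatoms_posRep_one_one
      omega
    · omega
  · have h4 := le_ncard_coatoms_negRep (by omega) hp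
    obtain rfl := h0 (by omega)
    split_ifs at h2 h4 <;> omega

theorem not_sameTop_negRep_one {p p' : ℤ} (hp : 1 ≤ p) (hp' : 0 ≤ p')
    (h : SameTop (negRep p 1) (negRep p' 0)) : False := by
  have h1 : p' = p + 1 := by
    have := h.len_eq
    simp only [len, negRep] at this
    omega
  subst h1
  have h2 := ncard_coatoms_negRep_zero (p := p + 1) (by omega)
  have h3 := le_ncard_coatoms_negRep le_rfl hp
  have h4 := h.ncard_eq
  split_ifs at h3 with h5
  · subst h5
    exact not_hasDiamond_negRep_two_zero (h.diamond hasDiamond_negRep_one_one)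
  · omega

/-- Representatives are determined by the data at the top of their lower intervals. -/
theorem eq_of_sameTop {a b : Alcove} (ha : IsRep a) (hb : IsRep b) (h : SameTop a b)
    (h' : SameTop b a) : a = b := by
  have hlen := h.len_eq
  rcases Nat.eq_zero_or_pos (len a) with h0 | hpos
  · obtain ⟨x, y, z⟩ := a
    obtain ⟨x', y', z'⟩ := b
    simp only [len, Prod.mk.injEq] at *
    omega
  have hab := minAbs_le_of_sameTop ha hb h hpos
  have hba := minAbs_le_of_sameTop hb ha h' (hlen ▸ hpos)
  obtain ⟨p, q, hp, h1⟩ := ha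
  obtain ⟨p', q', hp', h2⟩ := hb
  rcases h1 with ⟨hq, rfl⟩ | ⟨hq, rfl⟩ | ⟨hq, rfl⟩ <;>
  rcases h2 with ⟨hq', rfl⟩ | ⟨hq', rfl⟩ | ⟨hq', rfl⟩
  · have l := len_evenRep hq hp
    have l' := len_evenRep hq' hp'
    have n := minAbs_evenRep hq hp
    have n' := minAbs_evenRep hq' hp'
    have e : q = q' ∨ (q = 0 ∧ q' = 1) ∨ (q = 1 ∧ q' = 0) := by omega
    rcases e with rfl | ⟨rfl, rfl⟩ | ⟨rfl, rfl⟩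
    · rw [show p = p' by omega]
    · exact (not_sameTop_evenRep hp' h' (by omega)).elim
    · exact (not_sameTop_evenRep hp h (by omega)).elim
  · have l := len_evenRep hq hp
    have l' := len_posRep hq' hp'
    omega
  · have l := len_evenRep hq hp
    have l' := len_negRep hq' hp'
    omega
  · have l := len_posRep hq hp
    have l' := len_evenRep hq' hp'
    omega
  · have l := len_posRep hq hp
    have l' := len_posRep hq' hp'
    have n := minAbs_posRep hq hp
    have n' := minAbs_posRep hq' hp'
    rw [show q = q' by omega, show p = p' by omega]
  · have n := minAbs_posRep hq hp
    have n' := minAbs_negRep hq' hp'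
    exact (not_sameTop_negRep_posRep hq' hp' hq hp h' (by omega) (by omega) (by omega)).elim
  · have l := len_negRep hq hp
    have l' := len_evenRep hq' hp'
    omega
  · have n := minAbs_negRep hq hp
    have n' := minAbs_posRep hq' hp'
    exact (not_sameTop_negRep_posRep hq hp hq' hp' h (by omega) (by omega) (by omega)).elim
  · have l := len_negRep hq hp
    have l' := len_negRep hq' hp'
    have n := minAbs_negRep hq hp
    have n' := minAbs_negRep hq' hp'
    have e : q = q' ∨ (q = 0 ∧ q' = 1) ∨ (q = 1 ∧ q' = 0) := by omega
    rcases e with rfl | ⟨rfl, rfl⟩ | ⟨rfl, rfl⟩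
    · rw [show p = p' by omega]
    · exact (not_sameTop_negRep_one hp' (by omega) h').elim
    · exact (not_sameTop_negRep_one hp (by omega) h).elim

/-- Cyclic rotations of the coordinates. -/
def rot : Fin 3 → Alcove → Alcove
  | 0, (x, y, z) => (x, y, z)
  | 1, (x, y, z) => (z, x, y)
  | 2, (x, y, z) => (y, z, x)

/-- Transpositions of the coordinates. -/
def transp : Fin 3 → Alcove → Alcove
  | 0, (x, y, z) => (x, z, y)
  | 1, (x, y, z) => (z, y, x)
  | 2, (x, y, z) => (y, x, z)

theorem transp_rot (i j : Fin 3) (a : Alcove) : transp i (rot j a) = transp (i + j) a := by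
  rcases eq_zero_or_one_or_two i with rfl | rfl | rfl <;>
  rcases eq_zero_or_one_or_two j with rfl | rfl | rfl <;> rfl

theorem transp_transp (i j : Fin 3) (a : Alcove) : transp i (transp j a) = rot (j - i) a := by
  rcases eq_zero_or_one_or_two i with rfl | rfl | rfl <;>
  rcases eq_zero_or_one_or_two j with rfl | rfl | rfl <;> rfl

theorem rot_rot (i j : Fin 3) (a : Alcove) : rot i (rot j a) = rot (i + j) a := by
  rcases eq_zero_or_one_or_two i with rfl | rfl | rfl <;>
  rcases eq_zero_or_one_or_two j with rfl | rfl | rfl <;> rfl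

theorem refl_add (i : Fin 3) (a b : Alcove) : refl i 0 (a + b) = refl i 0 a - transp i b := by
  obtain ⟨x, y, z⟩ := a
  obtain ⟨x', y', z'⟩ := b
  rcases eq_zero_or_one_or_two i with rfl | rfl | rfl <;>
  simp only [refl, transp, Prod.mk_sub_mk, Prod.mk.injEq] <;> omega

theorem refl_sub (i : Fin 3) (a b : Alcove) : refl i 0 (a - b) = refl i 0 a + transp i b := by
  obtain ⟨x, y, z⟩ := a
  obtain ⟨x', y', z'⟩ := b
  rcases eq_zero_or_one_or_two i with rfl | rfl | rfl <;>
  simp only [refl, transp, Prod.mk_sub_mk, Prod.mk.injEq, Prod.mk_add_mk] <;> omega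

theorem sum_refl_zero (i : Fin 3) (a : Alcove) : (refl i 0 a).1 + (refl i 0 a).2.1 +
    (refl i 0 a).2.2 = -1 - (a.1 + a.2.1 + a.2.2) := by
  obtain ⟨x, y, z⟩ := a
  rcases eq_zero_or_one_or_two i with rfl | rfl | rfl <;> simp only [refl] <;> omega

theorem rot_one_refl (i : Fin 3) (a : Alcove) : rot 1 (refl i 0 a) = refl (i + 1) 0 (rot 1 a) := by
  rcases eq_zero_or_one_or_two i with rfl | rfl | rfl <;> rfl

theorem transp_zero_refl (i : Fin 3) (a : Alcove) :
    transp 0 (refl i 0 a) = refl (-i) 0 (transp 0 a) := by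
  rcases eq_zero_or_one_or_two i with rfl | rfl | rfl <;> rfl

theorem label_rot (i : Fin 3) (a : Alcove) : label (rot i a) = label a := by
  obtain ⟨x, y, z⟩ := a
  rcases eq_zero_or_one_or_two i with rfl | rfl | rfl <;>
  simp only [rot, label, len, maxAbs, minAbs, Prod.mk.injEq] <;> omega

theorem label_transp (i : Fin 3) (a : Alcove) : label (transp i a) = label a := by
  obtain ⟨x, y, z⟩ := a
  rcases eq_zero_or_one_or_two i with rfl | rfl | rfl <;>
  simp only [transp, label, len, maxAbs, minAbs, Prod.mk.injEq] <;> omega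

theorem label_neg (a : Alcove) : label (-a) = label a := by
  simp [label, len, maxAbs, minAbs]

theorem isRep_or_isRep_swap {x y z : ℤ} (h : (x + y + z = 0 ∧ y ≤ 0 ∧ z ≤ 0) ∨
    (x + y + z = -1 ∧ y < 0 ∧ z < 0) ∨ (x + y + z = -1 ∧ 0 ≤ y ∧ 0 ≤ z)) :
    IsRep (x, y, z) ∨ IsRep (x, z, y) := by
  wlog hyz : y.natAbs ≥ z.natAbs generalizing y z
  · exact (this (y := z) (z := y) (by omega) (by omega)).symm
  left
  rcases h with h | h | h
  · exact ⟨-y, -z, by omega, .inl ⟨by omega, by simp only [evenRep, Prod.mk.injEq]; omega⟩⟩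
  · exact ⟨-y, -z, by omega, .inr (.inl ⟨by omega, by simp only [posRep, Prod.mk.injEq]; omega⟩)⟩
  · exact ⟨y, z, by omega,
      .inr (.inr ⟨by omega, by simp only [negRep, Prod.mk.injEq, and_true]; omega⟩)⟩

theorem exists_isRep_of {x y z : ℤ} (h : x + y + z = -1 ∨ (x + y + z = 0 ∧
    ((x ≤ 0 ∧ y ≤ 0) ∨ (y ≤ 0 ∧ z ≤ 0) ∨ (z ≤ 0 ∧ x ≤ 0)))) :
    ∃ i, IsRep (rot i (x, y, z)) ∨ IsRep (transp i (x, y, z)) := by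
  rcases h with h | ⟨h, h'⟩
  · have : (y < 0 ∧ z < 0) ∨ (0 ≤ y ∧ 0 ≤ z) ∨ (x < 0 ∧ z < 0) ∨ (0 ≤ x ∧ 0 ≤ z) ∨
        (x < 0 ∧ y < 0) ∨ (0 ≤ x ∧ 0 ≤ y) := by omega
    rcases this with h' | h' | h' | h' | h' | h'
    · exact ⟨0, isRep_or_isRep_swap (.inr (.inl ⟨h, h'⟩))⟩
    · exact ⟨0, isRep_or_isRep_swap (.inr (.inr ⟨h, h'⟩))⟩
    · exact ⟨2, (isRep_or_isRep_swap (.inr (.inl ⟨by omega, h'⟩))).symm⟩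
    · exact ⟨2, (isRep_or_isRep_swap (.inr (.inr ⟨by omega, h'⟩))).symm⟩
    · exact ⟨1, isRep_or_isRep_swap (.inr (.inl ⟨by omega, h'⟩))⟩
    · exact ⟨1, isRep_or_isRep_swap (.inr (.inr ⟨by omega, h'⟩))⟩
  · rcases h' with h' | h' | h'
    · exact ⟨1, isRep_or_isRep_swap (.inl ⟨by omega, h'⟩)⟩
    · exact ⟨0, isRep_or_isRep_swap (.inl ⟨h, h'⟩)⟩
    · exact ⟨2, (isRep_or_isRep_swap (.inl ⟨by omega, h'.symm⟩)).symm⟩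

theorem exists_isRep {a : Alcove} (h : IsAlcove a) :
    (∃ i, IsRep (rot i a) ∨ IsRep (transp i a)) ∨
      (a.1 + a.2.1 + a.2.2 = 0 ∧ ∃ i, IsRep (rot i (-a)) ∨ IsRep (transp i (-a))) := by
  obtain ⟨x, y, z⟩ := a
  have h : x + y + z = 0 ∨ x + y + z = -1 := h
  by_cases h' : x + y + z = -1 ∨ (x + y + z = 0 ∧
    ((x ≤ 0 ∧ y ≤ 0) ∨ (y ≤ 0 ∧ z ≤ 0) ∨ (z ≤ 0 ∧ x ≤ 0)))
  · exact .inl (exists_isRep_of h')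
  · exact .inr ⟨show x + y + z = 0 by omega,
      exists_isRep_of (x := -x) (y := -y) (z := -z) (.inr ⟨by omega, by omega⟩)⟩

section Automorphisms

variable {W : Type*} [Group W] {M : CoxeterMatrix (Fin 3)} (cs : CoxeterSystem M W)
  (hM : ∀ i j : Fin 3, M i j = if i = j then 1 else 3)

theorem act_eq (x : W) : ∃ i,
    ((alc cs hM x).1 + (alc cs hM x).2.1 + (alc cs hM x).2.2 = 0 ∧
      ∀ a, act cs hM x a = alc cs hM x + rot i a) ∨
    ((alc cs hM x).1 + (alc cs hM x).2.1 + (alc cs hM x).2.2 = -1 ∧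
      ∀ a, act cs hM x a = alc cs hM x - transp i a) := by
  induction x using cs.simple_induction_left with
  | one =>
    refine ⟨0, .inl ⟨by rw [alc_one cs hM]; rfl, fun a => ?_⟩⟩
    rw [act_one cs hM, alc_one cs hM]
    exact (zero_add a).symm
  | mul_simple_left x i ih =>
    obtain ⟨j, ⟨h0, h⟩ | ⟨h0, h⟩⟩ := ih
    · refine ⟨i + j, .inr ⟨?_, fun a => ?_⟩⟩
      · rw [alc_simple_mul cs hM, sum_refl_zero, h0]
        rfl
      · rw [act_mul cs hM, act_simple cs hM, alc_simple_mul cs hM, h, refl_add, transp_rot]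
    · refine ⟨j - i, .inl ⟨?_, fun a => ?_⟩⟩
      · rw [alc_simple_mul cs hM, sum_refl_zero, h0]
        rfl
      · rw [act_mul cs hM, act_simple cs hM, alc_simple_mul cs hM, h, refl_sub, transp_transp]

theorem alc_inv (x : W) : ∃ i,
    ((alc cs hM x).1 + (alc cs hM x).2.1 + (alc cs hM x).2.2 = 0 ∧
      rot i (alc cs hM x⁻¹) = -alc cs hM x) ∨
    ((alc cs hM x).1 + (alc cs hM x).2.1 + (alc cs hM x).2.2 = -1 ∧
      transp i (alc cs hM x⁻¹) = alc cs hM x) := by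
  have h0 : act cs hM x (alc cs hM x⁻¹) = 0 := by
    rw [← alc_mul cs hM, mul_inv_cancel, alc_one cs hM]
    rfl
  obtain ⟨i, ⟨hs, h⟩ | ⟨hs, h⟩⟩ := act_eq cs hM x
  · rw [h] at h0
    exact ⟨i, .inl ⟨hs, eq_neg_of_add_eq_zero_right h0⟩⟩
  · rw [h] at h0
    exact ⟨i, .inr ⟨hs, (sub_eq_zero.mp h0).symm⟩⟩

theorem label_alc_inv (x : W) : label (alc cs hM x⁻¹) = label (alc cs hM x) := by
  obtain ⟨i, ⟨-, h⟩ | ⟨-, h⟩⟩ := alc_inv cs hM x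
  · rw [← label_neg (alc cs hM x), ← h, label_rot]
  · rw [← h, label_transp]

theorem rot_alc_inv {x : W} (hx : (alc cs hM x).1 + (alc cs hM x).2.1 + (alc cs hM x).2.2 = 0) :
    ∃ i, rot i (alc cs hM x⁻¹) = -alc cs hM x := by
  obtain ⟨i, ⟨-, h⟩ | ⟨h, -⟩⟩ := alc_inv cs hM x
  · exact ⟨i, h⟩
  · omega

variable {dl sg : W ≃* W}

theorem alc_map_dl (hdl : ∀ i : Fin 3, dl (cs.simple i) = cs.simple (i + 1)) (x : W) :
    alc cs hM (dl x) = rot 1 (alc cs hM x) := by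
  induction x using cs.simple_induction_left with
  | one => rw [map_one, alc_one cs hM]; rfl
  | mul_simple_left x i ih =>
    rw [map_mul, hdl, alc_simple_mul cs hM, alc_simple_mul cs hM, ih, rot_one_refl]

theorem alc_map_sg (hsg : ∀ i : Fin 3, sg (cs.simple i) = cs.simple (-i)) (x : W) :
    alc cs hM (sg x) = transp 0 (alc cs hM x) := by
  induction x using cs.simple_induction_left with
  | one => rw [map_one, alc_one cs hM]; rfl
  | mul_simple_left x i ih =>
    rw [map_mul, hsg, alc_simple_mul cs hM, alc_simple_mul cs hM, ih, transp_zero_refl]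

end Automorphisms

section Bruhat

variable {B W : Type*} [Group W] {M : CoxeterMatrix B} {cs : CoxeterSystem M W}

theorem length_lt_of_bruhatLT {x y : W} (h : bruhatLT cs x y) : cs.length x < cs.length y := by
  induction h with
  | single h => exact h.2
  | tail _ h ih => exact ih.trans h.2

theorem bruhatLE_trans {x y z : W} (h : bruhatLE cs x y) (h' : bruhatLE cs y z) :
    bruhatLE cs x z := by
  rcases h with rfl | h
  · exact h'
  rcases h' with rfl | h'
  · exact .inr h
  · exact .inr (Relation.TransGen.trans h h')

theorem length_lt_of_bruhatLE {x y : W} (h : bruhatLE cs x y) (hne : x ≠ y) :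
    cs.length x < cs.length y :=
  length_lt_of_bruhatLT (h.resolve_left hne)

theorem bruhatLE_antisymm {x y : W} (h : bruhatLE cs x y) (h' : bruhatLE cs y x) : x = y := by
  by_contra hne
  exact lt_asymm (length_lt_of_bruhatLE h hne) (length_lt_of_bruhatLE h' (Ne.symm hne))

theorem bruhatLE_of_isReflection {t x : W} (ht : cs.IsReflection t)
    (h : cs.length x < cs.length (t * x)) : bruhatLE cs x (t * x) :=
  .inr (.single ⟨⟨t, ht, rfl⟩, h⟩)

variable (cs) in
theorem exists_bruhatLE_of_ne_one {x : W} (hx : x ≠ 1) :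
    ∃ y, bruhatLE cs y x ∧ cs.length x = cs.length y + 1 := by
  obtain ⟨i, hi⟩ := cs.exists_leftDescent_of_ne_one hx
  rw [cs.isLeftDescent_iff] at hi
  refine ⟨cs.simple i * x, ?_, hi.symm⟩
  have h := bruhatLE_of_isReflection (cs.isReflection_simple i) (x := cs.simple i * x)
  rw [cs.simple_mul_simple_cancel_left] at h
  exact h (by omega)

theorem exists_isReflection_of_bruhatLE {x y : W} (h : bruhatLE cs x y)
    (hl : cs.length y = cs.length x + 1) : ∃ t, cs.IsReflection t ∧ y = t * x := by
  have h := h.resolve_left (by rintro rfl; omega)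
  cases h with
  | single h => exact h.1
  | tail h h' =>
    have := length_lt_of_bruhatLT h
    have := h'.2
    omega

variable (cs) in
/-- The elements covered by `x` in the Bruhat order. -/
def cocovers (x : W) : Set W := {y | bruhatLE cs y x ∧ cs.length x = cs.length y + 1}

variable (cs) in
/-- Isomorphism of lower Bruhat intervals. -/
def LowerIso (u v : W) : Prop :=
  ∃ f : {z : W // bruhatLE cs z u} ≃ {z : W // bruhatLE cs z v},
    ∀ a b, bruhatLE cs a.1 b.1 ↔ bruhatLE cs (f a).1 (f b).1

theorem LowerIso.symm {u v : W} (h : LowerIso cs u v) : LowerIso cs v u := by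
  obtain ⟨f, hf⟩ := h
  exact ⟨f.symm, fun a b => by rw [hf, f.apply_symm_apply, f.apply_symm_apply]⟩

theorem LowerIso.trans {u v w : W} (h : LowerIso cs u v) (h' : LowerIso cs v w) :
    LowerIso cs u w := by
  obtain ⟨f, hf⟩ := h
  obtain ⟨g, hg⟩ := h'
  exact ⟨f.trans g, fun a b => (hf a b).trans (hg _ _)⟩

theorem lowerIso_of_forall {g : Equiv.Perm W}
    (hg : ∀ x y, bruhatLE cs x y ↔ bruhatLE cs (g x) (g y)) (u : W) : LowerIso cs u (g u) :=
  ⟨g.subtypeEquiv fun a => hg a u, fun a b => hg a b⟩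

section

variable {u v : W} {f : {z : W // bruhatLE cs z u} ≃ {z : W // bruhatLE cs z v}}

theorem length_le_of_forall (hf : ∀ a b, bruhatLE cs a.1 b.1 ↔ bruhatLE cs (f a).1 (f b).1)
    (z : {z : W // bruhatLE cs z u}) : cs.length z.1 ≤ cs.length (f z).1 := by
  obtain ⟨z, hz⟩ := z
  induction hn : cs.length z generalizing z with
  | zero => exact Nat.zero_le _
  | succ n ih =>
    obtain ⟨y, hy, hl⟩ := exists_bruhatLE_of_ne_one cs (x := z)
      (by rintro rfl; rw [cs.length_one] at hn; omega)
    have h := ih y (bruhatLE_trans hy hz) (by omega)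
    refine h.trans_lt (length_lt_of_bruhatLE
      ((hf ⟨y, bruhatLE_trans hy hz⟩ ⟨z, hz⟩).mp hy) fun e => ?_)
    have := congrArg (fun t => cs.length t.1) (f.injective (Subtype.ext e))
    simp only at this
    omega

theorem forall_symm (hf : ∀ a b, bruhatLE cs a.1 b.1 ↔ bruhatLE cs (f a).1 (f b).1) :
    ∀ a b, bruhatLE cs a.1 b.1 ↔ bruhatLE cs (f.symm a).1 (f.symm b).1 :=
  fun a b => by rw [hf, f.apply_symm_apply, f.apply_symm_apply]

theorem length_eq_of_forall (hf : ∀ a b, bruhatLE cs a.1 b.1 ↔ bruhatLE cs (f a).1 (f b).1)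
    (z : {z : W // bruhatLE cs z u}) : cs.length (f z).1 = cs.length z.1 := by
  refine le_antisymm ?_ (length_le_of_forall hf z)
  have h := length_le_of_forall (forall_symm hf) (f z)
  rwa [f.symm_apply_apply] at h

theorem apply_top_of_forall (hf : ∀ a b, bruhatLE cs a.1 b.1 ↔ bruhatLE cs (f a).1 (f b).1) :
    f ⟨u, .inl rfl⟩ = ⟨v, .inl rfl⟩ := by
  refine Subtype.ext (bruhatLE_antisymm (f _).2 ?_)
  have h := (hf (f.symm ⟨v, .inl rfl⟩) ⟨u, .inl rfl⟩).mp (f.symm _).2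
  rwa [f.apply_symm_apply] at h

theorem lowerIso_apply (hf : ∀ a b, bruhatLE cs a.1 b.1 ↔ bruhatLE cs (f a).1 (f b).1)
    (z : {z : W // bruhatLE cs z u}) : LowerIso cs z.1 (f z).1 := by
  refine ⟨⟨fun a => ⟨(f ⟨a.1, bruhatLE_trans a.2 z.2⟩).1, (hf _ z).mp a.2⟩,
    fun b => ⟨(f.symm ⟨b.1, bruhatLE_trans b.2 (f z).2⟩).1, ?_⟩, fun a => ?_, fun b => ?_⟩,
    fun a b => hf ⟨a.1, bruhatLE_trans a.2 z.2⟩ ⟨b.1, bruhatLE_trans b.2 z.2⟩⟩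
  · rw [hf, f.apply_symm_apply]
    exact b.2
  · simp
  · simp

theorem apply_mem_cocovers (hf : ∀ a b, bruhatLE cs a.1 b.1 ↔ bruhatLE cs (f a).1 (f b).1)
    {z w : {z : W // bruhatLE cs z u}} (h : z.1 ∈ cocovers cs w.1) :
    (f z).1 ∈ cocovers cs (f w).1 :=
  ⟨(hf z w).mp h.1, by rw [length_eq_of_forall hf, length_eq_of_forall hf, h.2]⟩

theorem ncard_cocovers_of_forall (hf : ∀ a b, bruhatLE cs a.1 b.1 ↔ bruhatLE cs (f a).1 (f b).1) :
    (cocovers cs u).ncard = (cocovers cs v).ncard := by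
  have htop := apply_top_of_forall hf
  refine Set.ncard_congr (fun z hz => (f ⟨z, hz.1⟩).1) (fun z hz => ?_) (fun a b ha hb h => ?_)
    (fun b hb => ?_)
  · have h := apply_mem_cocovers hf (z := ⟨z, hz.1⟩) (w := ⟨u, .inl rfl⟩) hz
    rwa [htop] at h
  · exact congrArg Subtype.val (f.injective (Subtype.ext h))
  · have h := apply_mem_cocovers (forall_symm hf) (z := ⟨b, hb.1⟩) (w := ⟨v, .inl rfl⟩) hb
    rw [← htop, f.symm_apply_apply] at h
    exact ⟨_, h, by simp⟩

end

end Bruhat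

section Classification

variable {W : Type*} [Group W] {M : CoxeterMatrix (Fin 3)} {cs : CoxeterSystem M W}
  (hM : ∀ i j : Fin 3, M i j = if i = j then 1 else 3)

theorem bruhatLE_map_mulEquiv (e : W ≃* W) (he : ∀ i, ∃ j, e (cs.simple i) = cs.simple j)
    (hl : ∀ x, cs.length (e x) = cs.length x) {x y : W} (h : bruhatLE cs x y) :
    bruhatLE cs (e x) (e y) := by
  rcases h with rfl | h
  · exact .inl rfl
  refine .inr (Relation.TransGen.lift e ?_ _ _ h)
  rintro a _ ⟨⟨_, ⟨w, i, rfl⟩, rfl⟩, hlt⟩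
  obtain ⟨j, hj⟩ := he i
  refine ⟨⟨_, ⟨e w, j, rfl⟩, by simp [hj]⟩, ?_⟩
  rwa [hl, hl]

theorem bruhatLE_map_mulEquiv_iff (e : W ≃* W) (he : ∀ i, ∃ j, e (cs.simple i) = cs.simple j)
    (he' : ∀ j, ∃ i, e (cs.simple i) = cs.simple j) (hl : ∀ x, cs.length (e x) = cs.length x)
    (x y : W) : bruhatLE cs x y ↔ bruhatLE cs (e x) (e y) := by
  refine ⟨bruhatLE_map_mulEquiv e he hl, fun h => ?_⟩
  have h' := bruhatLE_map_mulEquiv e.symm (fun i => ?_) (fun x => ?_) h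
  · simpa using h'
  · obtain ⟨j, hj⟩ := he' i
    exact ⟨j, by rw [← hj, e.symm_apply_apply]⟩
  · rw [← hl, e.apply_symm_apply]

theorem bruhatLE_inv {x y : W} (h : bruhatLE cs x y) : bruhatLE cs x⁻¹ y⁻¹ := by
  rcases h with rfl | h
  · exact .inl rfl
  refine .inr (Relation.TransGen.lift (fun z => z⁻¹) ?_ _ _ h)
  rintro a _ ⟨⟨t, ht, rfl⟩, hlt⟩
  refine ⟨⟨_, ht.conj a⁻¹, ?_⟩, ?_⟩
  · simp [mul_assoc, ht.inv]
  · rwa [cs.length_inv, cs.length_inv]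

/-- Generic automorphisms preserve the Bruhat order and the labels of alcoves. -/
theorem bruhatLE_iff_and_label_of_mem {dl sg : W ≃* W}
    (hdl : ∀ i : Fin 3, dl (cs.simple i) = cs.simple (i + 1))
    (hsg : ∀ i : Fin 3, sg (cs.simple i) = cs.simple (-i)) {g : Equiv.Perm W}
    (hg : g ∈ Gsub dl sg) :
    (∀ x y, bruhatLE cs x y ↔ bruhatLE cs (g x) (g y)) ∧
      ∀ x, label (alc cs hM (g x)) = label (alc cs hM x) := by
  have hlen : ∀ {x y : W}, label (alc cs hM x) = label (alc cs hM y) →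
      cs.length x = cs.length y := fun {x y} h => by
    rw [← len_alc cs hM x, ← len_alc cs hM y]
    exact congrArg Prod.fst h
  induction hg using Subgroup.closure_induction with
  | mem g hg =>
    rcases hg with rfl | rfl | rfl
    · have h : ∀ x, label (alc cs hM (dl x)) = label (alc cs hM x) := fun x => by
        rw [alc_map_dl cs hM hdl, label_rot]
      exact ⟨bruhatLE_map_mulEquiv_iff dl (fun i => ⟨_, hdl i⟩)
        (fun j => ⟨j - 1, by rw [hdl, sub_add_cancel]⟩) fun x => hlen (h x), h⟩
    · have h : ∀ x, label (alc cs hM (sg x)) = label (alc cs hM x) := fun x => by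
        rw [alc_map_sg cs hM hsg, label_transp]
      exact ⟨bruhatLE_map_mulEquiv_iff sg (fun i => ⟨_, hsg i⟩)
        (fun j => ⟨-j, by rw [hsg, neg_neg]⟩) fun x => hlen (h x), h⟩
    · exact ⟨fun x y => ⟨bruhatLE_inv, fun h => by simpa using bruhatLE_inv h⟩,
        label_alc_inv cs hM⟩
  | one => exact ⟨fun _ _ => Iff.rfl, fun _ => rfl⟩
  | mul g g' _ _ h h' =>
    exact ⟨fun x y => (h'.1 x y).trans (h.1 _ _), fun x => (h.2 _).trans (h'.2 x)⟩
  | inv g _ h =>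
    refine ⟨fun x y => ?_, fun x => ?_⟩
    · rw [h.1 (g⁻¹ x), Equiv.Perm.inv_def, g.apply_symm_apply, g.apply_symm_apply]
    · rw [← h.2 (g⁻¹ x), Equiv.Perm.inv_def, g.apply_symm_apply]

theorem exists_mem_isRep {dl sg : W ≃* W}
    (hdl : ∀ i : Fin 3, dl (cs.simple i) = cs.simple (i + 1))
    (hsg : ∀ i : Fin 3, sg (cs.simple i) = cs.simple (-i)) (u : W) :
    ∃ g ∈ Gsub dl sg, IsRep (alc cs hM (g u)) := by
  have hd : dl.toEquiv ∈ Gsub dl sg := Subgroup.subset_closure (by simp)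
  have hs : sg.toEquiv ∈ Gsub dl sg := Subgroup.subset_closure (by simp)
  have hi : Equiv.inv W ∈ Gsub dl sg := Subgroup.subset_closure (by simp)
  have hrot : ∀ i, ∃ g ∈ Gsub dl sg, ∀ x, alc cs hM (g x) = rot i (alc cs hM x) := by
    intro i
    have h1 : ∀ x, alc cs hM (dl.toEquiv x) = rot 1 (alc cs hM x) := alc_map_dl cs hM hdl
    rcases eq_zero_or_one_or_two i with rfl | rfl | rfl
    · exact ⟨1, one_mem _, fun x => rfl⟩
    · exact ⟨_, hd, h1⟩
    · exact ⟨_, mul_mem hd hd, fun x => by rw [Equiv.Perm.mul_apply, h1, h1, rot_rot]; rfl⟩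
  have htransp : ∀ i, ∃ g ∈ Gsub dl sg, ∀ x, alc cs hM (g x) = transp i (alc cs hM x) := by
    intro i
    obtain ⟨g, hg, h⟩ := hrot i
    refine ⟨_, mul_mem hs hg, fun x => ?_⟩
    rw [Equiv.Perm.mul_apply, MulEquiv.toEquiv_eq_coe, EquivLike.coe_coe, alc_map_sg cs hM hsg, h,
      transp_rot, zero_add]
  rcases exists_isRep (isAlcove_alc cs hM u) with ⟨i, h | h⟩ | ⟨h0, i, h⟩
  · obtain ⟨g, hg, e⟩ := hrot i
    exact ⟨g, hg, by rwa [e]⟩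
  · obtain ⟨g, hg, e⟩ := htransp i
    exact ⟨g, hg, by rwa [e]⟩
  · obtain ⟨j, hj⟩ := rot_alc_inv cs hM h0
    rw [← hj, rot_rot, transp_rot] at h
    rcases h with h | h
    · obtain ⟨g, hg, e⟩ := hrot (i + j)
      exact ⟨_, mul_mem hg hi, by rwa [Equiv.Perm.mul_apply, e]⟩
    · obtain ⟨g, hg, e⟩ := htransp (i + j)
      exact ⟨_, mul_mem hg hi, by rwa [Equiv.Perm.mul_apply, e]⟩

theorem coatoms_alc (w : W) : coatoms (alc cs hM w) = alc cs hM '' cocovers cs w := by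
  ext b
  constructor
  · rintro ⟨⟨i, m, rfl⟩, h⟩
    obtain ⟨t, ht, e⟩ := exists_isReflection_act_eq cs hM m i
    rw [← e, ← alc_mul cs hM, len_alc cs hM, len_alc cs hM] at h
    refine ⟨t * w, ⟨?_, h⟩, by rw [alc_mul cs hM, e]⟩
    have h' := bruhatLE_of_isReflection ht (x := t * w)
    rw [← mul_assoc, ht.mul_self, one_mul] at h'
    exact h' (by omega)
  · rintro ⟨z, ⟨hz, hl⟩, rfl⟩
    obtain ⟨t, ht, rfl⟩ := exists_isReflection_of_bruhatLE hz hl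
    obtain ⟨i, m, e⟩ := exists_act_eq_refl cs hM ht
    refine ⟨⟨i, m, ?_⟩, by rwa [len_alc cs hM, len_alc cs hM]⟩
    rw [alc_mul cs hM, e, refl_refl]

theorem sameTop_of_forall {u v : W} {f : {z : W // bruhatLE cs z u} ≃ {z : W // bruhatLE cs z v}}
    (hf : ∀ a b, bruhatLE cs a.1 b.1 ↔ bruhatLE cs (f a).1 (f b).1)
    (hlabel : ∀ z hz, cs.length z < cs.length u →
      label (alc cs hM (f ⟨z, hz⟩).1) = label (alc cs hM z)) :
    SameTop (alc cs hM u) (alc cs hM v) := by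
  have htop := apply_top_of_forall hf
  have hmem : ∀ {z} (hz : z ∈ cocovers cs u), (f ⟨z, hz.1⟩).1 ∈ cocovers cs v := fun {z} hz => by
    have h := apply_mem_cocovers hf (z := ⟨z, hz.1⟩) (w := ⟨u, .inl rfl⟩) hz
    rwa [htop] at h
  refine ⟨?_, ?_, ?_, ?_⟩
  · rw [len_alc cs hM, len_alc cs hM, ← length_eq_of_forall hf ⟨u, .inl rfl⟩, htop]
  · rw [coatoms_alc, coatoms_alc, Set.ncard_image_of_injective _ (alc_injective cs hM),
      Set.ncard_image_of_injective _ (alc_injective cs hM), ncard_cocovers_of_forall hf]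
  · rw [coatoms_alc, coatoms_alc]
    rintro _ ⟨z, hz, rfl⟩
    exact ⟨_, ⟨_, hmem hz, rfl⟩, hlabel z hz.1 (by have := hz.2; omega)⟩
  · simp only [HasDiamond, coatoms_alc]
    rintro ⟨_, ⟨b, hb, rfl⟩, _, ⟨c, hc, rfl⟩, hbc, lb, lc, d, hdb, hdc, ld⟩
    rw [coatoms_alc] at hdb hdc
    obtain ⟨d, hdb, rfl⟩ := hdb
    rw [(alc_injective cs hM).mem_set_image] at hdc
    have hbl := hb.2
    have hdl := hdb.2
    refine ⟨_, ⟨_, hmem hb, rfl⟩, _, ⟨_, hmem hc, rfl⟩, fun e => hbc ?_,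
      (hlabel b hb.1 (by omega)).trans lb,
      (hlabel c hc.1 (by have := hc.2; omega)).trans lc,
      alc cs hM (f ⟨d, bruhatLE_trans hdb.1 hb.1⟩).1, ?_, ?_,
      (hlabel d _ (by omega)).trans ld⟩
    · exact congrArg (fun t => alc cs hM t.1) (f.injective (Subtype.ext (alc_injective cs hM e)))
    · rw [coatoms_alc]
      exact ⟨_, apply_mem_cocovers hf (z := ⟨d, bruhatLE_trans hdb.1 hb.1⟩) (w := ⟨b, hb.1⟩) hdb,
        rfl⟩
    · rw [coatoms_alc]
      exact ⟨_, apply_mem_cocovers hf (z := ⟨d, bruhatLE_trans hdb.1 hb.1⟩) (w := ⟨c, hc.1⟩) hdc,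
        rfl⟩

theorem label_eq_of_lowerIso {dl sg : W ≃* W}
    (hdl : ∀ i : Fin 3, dl (cs.simple i) = cs.simple (i + 1))
    (hsg : ∀ i : Fin 3, sg (cs.simple i) = cs.simple (-i)) {u v : W} (h : LowerIso cs u v) :
    label (alc cs hM u) = label (alc cs hM v) := by
  induction hn : cs.length u using Nat.strong_induction_on generalizing u v with
  | _ n ih =>
  obtain ⟨g, hg, hgu⟩ := exists_mem_isRep hM hdl hsg u
  obtain ⟨g', hg', hgv⟩ := exists_mem_isRep hM hdl hsg v
  obtain ⟨hgle, hglab⟩ := bruhatLE_iff_and_label_of_mem hM hdl hsg hg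
  obtain ⟨hgle', hglab'⟩ := bruhatLE_iff_and_label_of_mem hM hdl hsg hg'
  rw [← hglab u, ← hglab' v]
  have hlen : cs.length (g u) = n := by
    rw [← hn, ← len_alc cs hM, ← len_alc cs hM]
    exact congrArg Prod.fst (hglab u)
  obtain ⟨f, hf⟩ := ((lowerIso_of_forall hgle u).symm.trans h).trans (lowerIso_of_forall hgle' v)
  have hlen' : cs.length (g' v) = n := by
    rw [← hlen, ← length_eq_of_forall hf ⟨g u, .inl rfl⟩, apply_top_of_forall hf]
  have h1 := sameTop_of_forall hM hf fun z hz hl =>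
    (ih _ (hlen ▸ hl) (lowerIso_apply hf ⟨z, hz⟩) rfl).symm
  have h2 := sameTop_of_forall hM (forall_symm hf) fun z hz hl =>
    (ih _ (hlen' ▸ hl) (lowerIso_apply (forall_symm hf) ⟨z, hz⟩) rfl).symm
  rw [eq_of_sameTop hgu hgv h1 h2]

end Classification

end AffineA2

/-- classification of lower Bruhat intervals in type `Ã₂`: `[e,u] ≅ [e,v]`
iff `v` lies in the `G`-orbit of `u`. -/
theorem statement17
    {W : Type*} [Group W] {M : CoxeterMatrix (Fin 3)} (cs : CoxeterSystem M W)
    (hM : ∀ i j : Fin 3, M i j = if i = j then 1 else 3)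
    (dl sg : W ≃* W)
    (hdl : ∀ i : Fin 3, dl (cs.simple i) = cs.simple (i + 1))
    (hsg0 : sg (cs.simple 0) = cs.simple 0)
    (hsg1 : sg (cs.simple 1) = cs.simple 2)
    (hsg2 : sg (cs.simple 2) = cs.simple 1)
    (u v : W) :
    (∃ f : {z : W // bruhatLE cs z u} ≃ {z : W // bruhatLE cs z v},
        ∀ a b, bruhatLE cs a.1 b.1 ↔ bruhatLE cs (f a).1 (f b).1) ↔
      ∃ g ∈ Gsub dl sg, g u = v := by
  have hsg : ∀ i : Fin 3, sg (cs.simple i) = cs.simple (-i) := fun i => by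
    rcases AffineA2.eq_zero_or_one_or_two i with rfl | rfl | rfl
    exacts [hsg0, hsg1, hsg2]
  constructor
  · intro h
    have hlab := AffineA2.label_eq_of_lowerIso hM hdl hsg h
    obtain ⟨g, hg, hgu⟩ := AffineA2.exists_mem_isRep hM hdl hsg u
    obtain ⟨g', hg', hgv⟩ := AffineA2.exists_mem_isRep hM hdl hsg v
    rw [← (AffineA2.bruhatLE_iff_and_label_of_mem hM hdl hsg hg).2 u,
      ← (AffineA2.bruhatLE_iff_and_label_of_mem hM hdl hsg hg').2 v] at hlab
    refine ⟨g'⁻¹ * g, mul_mem (inv_mem hg') hg, ?_⟩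
    rw [Equiv.Perm.mul_apply, Equiv.Perm.inv_eq_iff_eq]
    exact AffineA2.alc_injective cs hM (AffineA2.eq_of_label_eq hgu hgv hlab)
  · rintro ⟨g, hg, rfl⟩
    exact AffineA2.lowerIso_of_forall (AffineA2.bruhatLE_iff_and_label_of_mem hM hdl hsg hg).1 u
end
end

section
/- Let W be the affine Weyl group of type A~n and let x, y ∈ W+ be dominant elements with x ≤ y. For each i ∈ {0,1,…,n} define the i-th parallelotope Par^i_{x,y} := (x(−ϖi) + C) ∩ (y(−ϖi) − C), where C := {c1·α1 + ⋯ + cn·αn : c1,…,cn ∈ ℝ≥0} and x(−ϖi) denotes the image of the point −ϖi under the affine action of x on E. Then for every z ∈ W: z is dominant and z ∈ [x,y] if and only if z(−ϖi) ∈ Par^i_{x,y} ∩ C̄+ for every i ∈ {0,1,…,n}, where C̄+ := {v ∈ E : (αi,v) ≥ 0 for all 1 ≤ i ≤ n}. -/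
noncomputable section

open scoped RealInnerProductSpace

/-- The sum-zero hyperplane model of type `Aₙ`: `i`-th simple root `αᵢ = eᵢ - eᵢ₊₁`. -/
def rootA {n : ℕ} (i : Fin n) : EuclideanSpace ℝ (Fin (n + 1)) :=
  EuclideanSpace.single i.castSucc 1 - EuclideanSpace.single i.succ 1

/-- The highest root `θ = e₀ - eₙ`. -/
def hiRoot (n : ℕ) : EuclideanSpace ℝ (Fin (n + 1)) :=
  EuclideanSpace.single 0 1 - EuclideanSpace.single (Fin.last n) 1

/-- The positive roots `eᵢ - eⱼ`, `i < j`. -/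
def PhiPosN (n : ℕ) : Set (EuclideanSpace ℝ (Fin (n + 1))) :=
  {v | ∃ i j : Fin (n + 1), i < j ∧ v = EuclideanSpace.single i 1 - EuclideanSpace.single j 1}

/-- The affine reflection `s_{α,k}` in the hyperplane `{v | (α, v) = k}`, for a root `α`
with `(α, α) = 2`. -/
def reflN {n : ℕ} (a : EuclideanSpace ℝ (Fin (n + 1))) (k : ℝ)
    (v : EuclideanSpace ℝ (Fin (n + 1))) : EuclideanSpace ℝ (Fin (n + 1)) :=
  v - (⟪a, v⟫ - k) • a

/-- The fundamental alcove `A₊` of type `Ãₙ`. -/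
def AplusN (n : ℕ) : Set (EuclideanSpace ℝ (Fin (n + 1))) :=
  {v | ∀ a ∈ PhiPosN n, -1 < ⟪a, v⟫ ∧ ⟪a, v⟫ < 0}

/-- `z` is dominant: its alcove is contained in the dominant chamber `C₊`. -/
def DomN {n : ℕ} {W : Type*} [Group W]
    (act : W →* Equiv.Perm (EuclideanSpace ℝ (Fin (n + 1)))) (z : W) : Prop :=
  ⇑(act z) '' AplusN n ⊆ {v | ∀ i : Fin n, 0 < ⟪rootA i, v⟫}

/-- The cone of nonnegative real combinations of the simple roots. -/
def coneN (n : ℕ) : Set (EuclideanSpace ℝ (Fin (n + 1))) :=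
  {v | ∃ c : Fin n → ℝ, (∀ i, 0 ≤ c i) ∧ v = ∑ i, c i • rootA i}

/-- The root lattice `ℤΦ`. -/
def rootLatN (n : ℕ) : Set (EuclideanSpace ℝ (Fin (n + 1))) :=
  {v | ∃ c : Fin n → ℤ, v = ∑ i, c i • rootA i}

/-- The permutation of `ℤ` exchanging `i - 1 + k * N` and `i + k * N` for every integer `k`. -/
def adjSwap (N i m : ℤ) : ℤ :=
  if N ∣ m - i then m - 1 else if N ∣ m + 1 - i then m + 1 else m

lemma not_dvd_of_dvd_sub_one {N a : ℤ} (hN : 2 ≤ N) (h : N ∣ a) : ¬ N ∣ a - 1 := by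
  intro h'
  have h1 : N ∣ 1 := by simpa using dvd_sub h h'
  have := Int.le_of_dvd one_pos h1
  omega

lemma not_dvd_of_dvd_sub_two {N a : ℤ} (hN : 3 ≤ N) (h : N ∣ a) : ¬ N ∣ a - 2 := by
  intro h'
  have h1 : N ∣ 2 := by simpa using dvd_sub h h'
  have := Int.le_of_dvd two_pos h1
  omega

lemma adjSwap_of_dvd {N i m : ℤ} (h : N ∣ m - i) : adjSwap N i m = m - 1 := if_pos h

lemma adjSwap_of_dvd_succ {N i m : ℤ} (hN : 2 ≤ N) (h : N ∣ m + 1 - i) :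
    adjSwap N i m = m + 1 := by
  rw [adjSwap, if_neg, if_pos h]
  have := not_dvd_of_dvd_sub_one hN h
  rwa [show m + 1 - i - 1 = m - i by ring] at this

lemma adjSwap_of_not_dvd {N i m : ℤ} (h : ¬ N ∣ m - i) (h' : ¬ N ∣ m + 1 - i) :
    adjSwap N i m = m := by
  rw [adjSwap, if_neg h, if_neg h']

lemma adjSwap_adjSwap {N : ℤ} (hN : 2 ≤ N) (i m : ℤ) : adjSwap N i (adjSwap N i m) = m := by
  by_cases h : N ∣ m - i
  · rw [adjSwap_of_dvd h, adjSwap_of_dvd_succ hN (by simpa using h)]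
    ring
  by_cases h' : N ∣ m + 1 - i
  · rw [adjSwap_of_dvd_succ hN h', adjSwap_of_dvd h']
    ring
  rw [adjSwap_of_not_dvd h h', adjSwap_of_not_dvd h h']

/-- An adjacent transposition only reverses the order of the pairs it exchanges. -/
lemma dvd_of_adjSwap_lt {N i p q : ℤ} (hN : 2 ≤ N) (hpq : p < q)
    (h : adjSwap N i q < adjSwap N i p) : N ∣ q - i ∧ p = q - 1 := by
  unfold adjSwap at h
  have aux : ∀ m, N ∣ m - i → ¬ N ∣ m - 1 - i := fun m hm => by
    have := not_dvd_of_dvd_sub_one hN hm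
    rwa [show m - i - 1 = m - 1 - i by ring] at this
  split_ifs at h with h1 h2 h3 h4 h5 h6 h7
  · omega
  · exact ⟨h1, by omega⟩
  · omega
  · omega
  · omega
  · omega
  · omega
  · have : q = p + 1 := by omega
    subst this
    exact absurd (by assumption) h1
  · omega

/-- A homomorphism from the Coxeter group of type `Ãₙ` to the permutations of `ℤ` whose image
consists of affine permutations, sending simple reflections to adjacent transpositions. -/
structure IsAffineRep {n : ℕ} {W : Type*} [Group W] {M : CoxeterMatrix (Fin (n + 1))}
    (cs : CoxeterSystem M W) (P : W →* Equiv.Perm ℤ) : Prop where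
  pos : 1 ≤ n
  matrix : ∀ i j : Fin (n + 1), M i j =
    if i = j then 1 else if n = 1 then 0 else if j = i + 1 ∨ i = j + 1 then 3 else 2
  shift : ∀ w m, P w (m + (n + 1)) = P w m + (n + 1)
  simple : ∀ (i : Fin (n + 1)) m, P (cs.simple i) m = adjSwap (n + 1) (i : ℕ) m

lemma Fin.eq_of_dvd_sub {n : ℕ} {i j : Fin (n + 1)} (h : (n + 1 : ℤ) ∣ (j : ℕ) - (i : ℕ)) :
    i = j := by
  have hi := i.isLt
  have hj := j.isLt
  have := Int.eq_zero_of_abs_lt_dvd h (by rw [abs_lt]; constructor <;> omega)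
  exact Fin.ext (by omega)

lemma Fin.dvd_add_one_sub {n : ℕ} (i : Fin (n + 1)) :
    (n + 1 : ℤ) ∣ ((i + 1 : Fin (n + 1)) : ℕ) - ((i : ℕ) + 1) := by
  rcases eq_or_ne i (Fin.last n) with rfl | h
  · exact ⟨-1, by simp⟩
  · rw [Fin.val_add_one_of_lt (Fin.lt_last_iff_ne_last.2 h)]
    simp

lemma Fin.eq_add_one_of_dvd {n : ℕ} {i j : Fin (n + 1)}
    (h : (n + 1 : ℤ) ∣ (j : ℕ) - ((i : ℕ) + 1)) : j = i + 1 := by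
  refine (Fin.eq_of_dvd_sub ?_).symm
  have := dvd_sub h (Fin.dvd_add_one_sub i)
  rwa [sub_sub_sub_cancel_right] at this

namespace IsAffineRep

variable {n : ℕ} {W : Type*} [Group W] {M : CoxeterMatrix (Fin (n + 1))}
  {cs : CoxeterSystem M W} {P : W →* Equiv.Perm ℤ}

lemma shift_mul (h : IsAffineRep cs P) (w : W) (m k : ℤ) :
    P w (m + k * (n + 1)) = P w m + k * (n + 1) := by
  induction k using Int.induction_on with
  | zero => simp
  | succ k ih =>
    rw [show m + ((k : ℤ) + 1) * (n + 1) = m + k * (n + 1) + (n + 1) by ring, h.shift, ih]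
    ring
  | pred k ih =>
    have := h.shift w (m + (-(k : ℤ) - 1) * (n + 1))
    rw [show m + (-(k : ℤ) - 1) * (n + 1) + (n + 1) = m + -(k : ℤ) * (n + 1) by ring, ih] at this
    linarith

lemma two_le (h : IsAffineRep cs P) : (2 : ℤ) ≤ n + 1 := by
  have := h.pos
  omega

/-- Comparing the values of an affine permutation at adjacent places only depends on the
places modulo the period. -/
lemma lt_of_dvd (h : IsAffineRep cs P) (w : W) {m p : ℤ} (hi : (n + 1 : ℤ) ∣ m - p)
    (hw : P w (p - 1) < P w p) : P w (m - 1) < P w m := by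
  obtain ⟨k, hk⟩ := hi
  have h1 := h.shift_mul w p k
  have h2 := h.shift_mul w (p - 1) k
  rw [show m = p + k * (n + 1) by linarith, h1,
    show p + k * (n + 1) - 1 = p - 1 + k * (n + 1) by ring, h2]
  linarith

lemma mul_simple_apply (h : IsAffineRep cs P) (w : W) (i : Fin (n + 1)) (m : ℤ) :
    P (w * cs.simple i) m = P w (adjSwap (n + 1) (i : ℕ) m) := by
  rw [map_mul, Equiv.Perm.mul_apply, h.simple]

lemma mul_simple_inv_apply (h : IsAffineRep cs P) (w : W) (i : Fin (n + 1)) (m : ℤ) :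
    P (w * cs.simple i)⁻¹ m = adjSwap (n + 1) (i : ℕ) (P w⁻¹ m) := by
  rw [mul_inv_rev, map_mul, Equiv.Perm.mul_apply, cs.inv_simple, h.simple]

lemma commute (h : IsAffineRep cs P) {i j : Fin (n + 1)} (hij : i ≠ j) (h1 : j ≠ i + 1)
    (h2 : i ≠ j + 1) : cs.simple i * cs.simple j = cs.simple j * cs.simple i := by
  have hn : n ≠ 1 := by
    rintro rfl
    revert i j
    decide
  have := cs.simple_mul_simple_pow i j
  rw [h.matrix, if_neg hij, if_neg hn, if_neg (by tauto), pow_two] at this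
  have h3 := eq_inv_of_mul_eq_one_left this
  rwa [mul_inv_rev, cs.inv_simple, cs.inv_simple] at h3

lemma braid (h : IsAffineRep cs P) {i j : Fin (n + 1)} (hn : n ≠ 1) (hij : i ≠ j)
    (h1 : j = i + 1 ∨ i = j + 1) :
    cs.simple i * cs.simple j * cs.simple i = cs.simple j * cs.simple i * cs.simple j := by
  have := cs.simple_mul_simple_pow i j
  rw [h.matrix, if_neg hij, if_neg hn, if_pos h1, pow_three] at this
  have h3 : (cs.simple i * cs.simple j * cs.simple i) *
      (cs.simple j * cs.simple i * cs.simple j) = 1 := by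
    simpa only [mul_assoc] using this
  have h4 := eq_inv_of_mul_eq_one_left h3
  simpa only [mul_inv_rev, cs.inv_simple, mul_assoc] using h4

end IsAffineRep

namespace IsAffineRep

variable {n : ℕ} {W : Type*} [Group W] {M : CoxeterMatrix (Fin (n + 1))}
  {cs : CoxeterSystem M W} {P : W →* Equiv.Perm ℤ}

/-- If right multiplication by a simple reflection increases the length, the affine permutation
ascends at the corresponding places. -/
theorem lt_of_length_lt (h : IsAffineRep cs P) (w : W) (i : Fin (n + 1))
    (hi : cs.length w < cs.length (w * cs.simple i)) (m : ℤ) (hm : (n + 1 : ℤ) ∣ m - (i : ℕ)) :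
    P w (m - 1) < P w m := by
  induction hk : cs.length w using Nat.strong_induction_on generalizing w i m with
  | _ k ih =>
  subst hk
  have hN := h.two_le
  rcases eq_or_ne w 1 with rfl | hw
  · simp
  obtain ⟨j, hj⟩ := cs.exists_rightDescent_of_ne_one hw
  rw [cs.isRightDescent_iff] at hj
  obtain ⟨u, rfl⟩ : ∃ u, w = u * cs.simple j := ⟨w * cs.simple j, by simp⟩
  rw [cs.simple_mul_simple_cancel_right] at hj
  have hij : i ≠ j := by
    rintro rfl
    rw [cs.simple_mul_simple_cancel_right] at hi
    omega
  have hmj : ¬ (n + 1 : ℤ) ∣ m - (j : ℕ) := fun hd => by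
    refine hij (Fin.eq_of_dvd_sub ?_)
    have := dvd_sub hm hd
    rwa [sub_sub_sub_cancel_left] at this
  have hu := fun m hm => ih (cs.length u) (by omega) u j (by omega) m hm rfl
  rw [h.mul_simple_apply, h.mul_simple_apply]
  by_cases hn : n = 1
  · subst hn
    norm_num at hm hmj hu ⊢
    have h1 : (2 : ℤ) ∣ m + 1 - (j : ℕ) := by omega
    rw [adjSwap_of_dvd (by simpa using (by omega : (2 : ℤ) ∣ m - 1 - (j : ℕ))),
      adjSwap_of_dvd_succ le_rfl h1]
    have h2 := hu (m + 1) h1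
    have h3 := h.shift u (m - 1 - 1)
    rw [add_sub_cancel_right] at h2
    norm_num at h3
    rw [show m - 1 - 1 + 2 = m by ring] at h3
    omega
  have hN3 : (3 : ℤ) ≤ n + 1 := by have := h.pos; omega
  by_cases hji : j = i + 1
  · have hjm : (n + 1 : ℤ) ∣ m + 1 - (j : ℕ) := by
      have := dvd_sub hm (Fin.dvd_add_one_sub i)
      rw [← hji] at this
      rwa [show m - (i : ℕ) - ((j : ℕ) - ((i : ℕ) + 1)) = m + 1 - ((j : ℕ) : ℤ) by ring] at this
    have h2 := not_dvd_of_dvd_sub_two hN3 hjm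
    rw [show m + 1 - (j : ℕ) - 2 = m - 1 - ((j : ℕ) : ℤ) by ring] at h2
    rw [adjSwap_of_dvd_succ hN hjm, adjSwap_of_not_dvd h2 (by simpa using hmj)]
    have h3 := hu (m + 1) hjm
    rw [add_sub_cancel_right] at h3
    rcases cs.length_mul_simple u i with hui | hui
    · exact (ih _ (by omega) u i (by omega) m hm rfl).trans h3
    obtain ⟨v, rfl⟩ : ∃ v, u = v * cs.simple i := ⟨u * cs.simple i, by simp⟩
    rw [cs.simple_mul_simple_cancel_right] at hui
    have hv : cs.length v < cs.length (v * cs.simple j) := by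
      by_contra hc
      have hb := h.braid hn hij (Or.inl hji)
      have h5 := cs.length_mul_le (v * cs.simple j) (cs.simple i * cs.simple j)
      have h6 := cs.length_mul_le (cs.simple i) (cs.simple j)
      rw [cs.length_simple, cs.length_simple] at h6
      have h7 := cs.length_mul_simple_ne v j
      rw [show v * cs.simple i * cs.simple j * cs.simple i
        = v * cs.simple j * (cs.simple i * cs.simple j) by
          simpa only [mul_assoc] using congrArg (v * ·) hb] at hi
      omega
    have h4 := ih _ (by omega) v j hv (m + 1) hjm rfl
    rw [add_sub_cancel_right] at h4
    have h8 : ¬ (n + 1 : ℤ) ∣ m + 1 - (i : ℕ) := fun hd => by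
      have := not_dvd_of_dvd_sub_one hN hd
      exact this (by rwa [show m + 1 - (i : ℕ) - 1 = m - ((i : ℕ) : ℤ) by ring])
    have h9 : ¬ (n + 1 : ℤ) ∣ m + 1 + 1 - (i : ℕ) := fun hd => by
      have := not_dvd_of_dvd_sub_two hN3 hd
      exact this (by rwa [show m + 1 + 1 - (i : ℕ) - 2 = m - ((i : ℕ) : ℤ) by ring])
    rw [h.mul_simple_apply, h.mul_simple_apply, adjSwap_of_not_dvd h8 h9,
      adjSwap_of_dvd_succ hN (by simpa using hm)]
    simpa using h4
  by_cases hji' : i = j + 1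
  · have hjm : (n + 1 : ℤ) ∣ m - 1 - (j : ℕ) := by
      have := dvd_add hm (Fin.dvd_add_one_sub j)
      rw [← hji'] at this
      rwa [show m - (i : ℕ) + ((i : ℕ) - ((j : ℕ) + 1)) = m - 1 - ((j : ℕ) : ℤ) by ring] at this
    have h2 : ¬ (n + 1 : ℤ) ∣ m + 1 - (j : ℕ) := fun hd => by
      have := not_dvd_of_dvd_sub_two hN3 hd
      exact this (by rwa [show m + 1 - (j : ℕ) - 2 = m - 1 - ((j : ℕ) : ℤ) by ring])
    rw [adjSwap_of_dvd hjm, adjSwap_of_not_dvd hmj h2]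
    have h3 := hu (m - 1) hjm
    rcases cs.length_mul_simple u i with hui | hui
    · exact h3.trans (ih _ (by omega) u i (by omega) m hm rfl)
    obtain ⟨v, rfl⟩ : ∃ v, u = v * cs.simple i := ⟨u * cs.simple i, by simp⟩
    rw [cs.simple_mul_simple_cancel_right] at hui
    have hv : cs.length v < cs.length (v * cs.simple j) := by
      by_contra hc
      have hb := h.braid hn hij (Or.inr hji')
      have h5 := cs.length_mul_le (v * cs.simple j) (cs.simple i * cs.simple j)
      have h6 := cs.length_mul_le (cs.simple i) (cs.simple j)
      rw [cs.length_simple, cs.length_simple] at h6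
      have h7 := cs.length_mul_simple_ne v j
      rw [show v * cs.simple i * cs.simple j * cs.simple i
        = v * cs.simple j * (cs.simple i * cs.simple j) by
          simpa only [mul_assoc] using congrArg (v * ·) hb] at hi
      omega
    have h4 := ih _ (by omega) v j hv (m - 1) hjm rfl
    have h8 : ¬ (n + 1 : ℤ) ∣ m - 1 - 1 - (i : ℕ) := by
      have := not_dvd_of_dvd_sub_two hN3 hm
      rwa [show m - (i : ℕ) - 2 = m - 1 - 1 - ((i : ℕ) : ℤ) by ring] at this
    have h9 : ¬ (n + 1 : ℤ) ∣ m - 1 - 1 + 1 - (i : ℕ) := by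
      have := not_dvd_of_dvd_sub_one hN hm
      rwa [show m - (i : ℕ) - 1 = m - 1 - 1 + 1 - ((i : ℕ) : ℤ) by ring] at this
    rw [h.mul_simple_apply, h.mul_simple_apply, adjSwap_of_not_dvd h8 h9, adjSwap_of_dvd hm]
    exact h4
  · have h1 : ¬ (n + 1 : ℤ) ∣ m + 1 - (j : ℕ) := fun hd => by
      refine hji (Fin.eq_add_one_of_dvd ?_)
      have := dvd_sub hm hd
      rwa [show m - (i : ℕ) - (m + 1 - (j : ℕ)) = (j : ℕ) - (((i : ℕ) : ℤ) + 1) by ring] at this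
    have h2 : ¬ (n + 1 : ℤ) ∣ m - 1 - (j : ℕ) := fun hd => by
      refine hji' (Fin.eq_add_one_of_dvd ?_)
      have := dvd_sub hd hm
      rwa [show m - 1 - (j : ℕ) - (m - (i : ℕ)) = (i : ℕ) - (((j : ℕ) : ℤ) + 1) by ring] at this
    rw [adjSwap_of_not_dvd hmj h1, adjSwap_of_not_dvd h2 (by simpa using hmj)]
    refine ih _ (by omega) u i ?_ m hm rfl
    have hc := h.commute hij hji hji'
    rw [mul_assoc, ← hc, ← mul_assoc] at hi
    have h5 := cs.length_mul_simple (u * cs.simple i) j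
    have h6 := cs.length_mul_simple_ne u i
    omega

theorem length_lt_iff (h : IsAffineRep cs P) (w : W) (i : Fin (n + 1)) {m : ℤ}
    (hm : (n + 1 : ℤ) ∣ m - (i : ℕ)) :
    cs.length w < cs.length (w * cs.simple i) ↔ P w (m - 1) < P w m := by
  refine ⟨fun hl => h.lt_of_length_lt w i hl m hm, fun hl => ?_⟩
  by_contra hc
  have h1 := cs.length_mul_simple_ne w i
  have h2 := h.lt_of_length_lt (w * cs.simple i) i (by simp; omega) m hm
  rw [h.mul_simple_apply, h.mul_simple_apply, adjSwap_of_dvd hm,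
    adjSwap_of_dvd_succ h.two_le (by simpa using hm), sub_add_cancel] at h2
  exact lt_asymm hl h2

theorem injective (h : IsAffineRep cs P) : Function.Injective P := by
  rw [injective_iff_map_eq_one]
  intro w hw
  by_contra hne
  obtain ⟨i, hi⟩ := cs.exists_rightDescent_of_ne_one hne
  have h1 := (h.length_lt_iff w i (m := (i : ℕ)) (by simp)).2 (by simp [hw])
  exact lt_asymm h1 hi

/-- Two reflections exchanging the same values of affine permutations are equal. -/
theorem conj_simple_eq (h : IsAffineRep cs P) (u v : W) (i j : Fin (n + 1))
    (hd : (n + 1 : ℤ) ∣ P v⁻¹ (P u (i : ℕ)) - (j : ℕ))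
    (he : P v⁻¹ (P u ((i : ℕ) - 1)) = P v⁻¹ (P u (i : ℕ)) - 1) :
    u * cs.simple i * u⁻¹ = v * cs.simple j * v⁻¹ := by
  have key : v⁻¹ * u * cs.simple i = cs.simple j * (v⁻¹ * u) := by
    apply h.injective
    ext m
    have hg : ∀ m, P v⁻¹ (P u m) = P (v⁻¹ * u) m := fun m => by
      rw [map_mul, Equiv.Perm.mul_apply]
    rw [hg, hg] at he
    rw [hg] at hd
    rw [h.mul_simple_apply, map_mul P (cs.simple j), Equiv.Perm.mul_apply, h.simple]
    set g := v⁻¹ * u with hgdef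
    have hval : ∀ m c : ℤ, (n + 1 : ℤ) ∣ P g m - P g c → (n + 1 : ℤ) ∣ m - c := by
      rintro m c ⟨l, hl⟩
      refine ⟨l, ?_⟩
      have := h.shift_mul g c l
      have h3 : m = c + l * (n + 1) := (P g).injective (by linarith)
      rw [h3]
      ring
    have hval' : ∀ m c : ℤ, (n + 1 : ℤ) ∣ m - c → P g m - m = P g c - c := by
      rintro m c ⟨l, hl⟩
      have := h.shift_mul g c l
      rw [show m = c + l * (n + 1) by linarith, this]
      ring
    by_cases h1 : (n + 1 : ℤ) ∣ m - (i : ℕ)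
    · have h2 := hval' m _ h1
      have h3 := hval' (m - 1) ((i : ℕ) - 1) (by simpa using h1)
      rw [adjSwap_of_dvd h1, adjSwap_of_dvd]
      · linarith
      · have := dvd_add h1 hd
        rwa [show m - ((i : ℕ) : ℤ) + (P g (i : ℕ) - (j : ℕ)) = P g m - (j : ℕ) by
          linarith] at this
    by_cases h2 : (n + 1 : ℤ) ∣ m + 1 - (i : ℕ)
    · have h3 := hval' (m + 1) _ h2
      have h4 := hval' m ((i : ℕ) - 1) (by simpa [sub_sub_eq_add_sub] using h2)
      rw [adjSwap_of_dvd_succ h.two_le h2, adjSwap_of_dvd_succ h.two_le]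
      · linarith
      · have := dvd_add h2 hd
        rwa [show m + 1 - ((i : ℕ) : ℤ) + (P g (i : ℕ) - (j : ℕ)) = P g m + 1 - (j : ℕ) by
          linarith] at this
    · rw [adjSwap_of_not_dvd h1 h2, adjSwap_of_not_dvd]
      · intro h3
        apply h1
        apply hval
        have := dvd_sub h3 hd
        rwa [sub_sub_sub_cancel_right] at this
      · intro h3
        apply h2
        have h4 := hval m ((i : ℕ) - 1) (by
          have := dvd_sub h3 hd
          rw [he]
          rwa [show P g m + 1 - (j : ℕ) - (P g (i : ℕ) - (j : ℕ)) =
            P g m - (P g (i : ℕ) - 1) by ring] at this)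
        rwa [show m - (((i : ℕ) : ℤ) - 1) = m + 1 - (i : ℕ) by ring] at h4
  have key' : u * cs.simple i = v * cs.simple j * v⁻¹ * u := by
    rw [mul_assoc (v * _), mul_assoc v, ← key]
    group
  rw [key', mul_inv_cancel_right]

/-- Left multiplication by the reflection exchanging `a < b` decreases the length of `w`
as soon as `b` occurs before `a` among the values of `w`. -/
theorem length_reflection_mul_lt (h : IsAffineRep cs P) (u w : W) (i : Fin (n + 1))
    (hu : P u ((i : ℕ) - 1) < P u (i : ℕ))
    (hw : P w⁻¹ (P u (i : ℕ)) < P w⁻¹ (P u ((i : ℕ) - 1))) :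
    cs.length (u * cs.simple i * u⁻¹ * w) < cs.length w := by
  induction hk : cs.length w using Nat.strong_induction_on generalizing w with
  | _ k ih =>
  subst hk
  rcases eq_or_ne w 1 with rfl | hne
  · simp at hw
    exact absurd hw hu.not_gt
  obtain ⟨j, hj⟩ := cs.exists_rightDescent_of_ne_one hne
  rw [cs.isRightDescent_iff] at hj
  obtain ⟨v, rfl⟩ : ∃ v, w = v * cs.simple j := ⟨w * cs.simple j, by simp⟩
  rw [cs.simple_mul_simple_cancel_right] at hj
  rcases lt_or_ge (P v⁻¹ (P u (i : ℕ))) (P v⁻¹ (P u ((i : ℕ) - 1))) with hlt | hge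
  · have h1 := ih _ (by omega) v hlt rfl
    have h2 := cs.length_mul_simple (u * cs.simple i * u⁻¹ * v) j
    rw [← mul_assoc]
    omega
  rw [h.mul_simple_inv_apply, h.mul_simple_inv_apply] at hw
  have hlt : P v⁻¹ (P u ((i : ℕ) - 1)) < P v⁻¹ (P u (i : ℕ)) := by
    refine lt_of_le_of_ne hge fun he => ?_
    rw [he] at hw
    exact lt_irrefl _ hw
  obtain ⟨hd, he⟩ := dvd_of_adjSwap_lt h.two_le hlt hw
  rw [h.conj_simple_eq u v i j hd he, ← mul_assoc, inv_mul_cancel_right,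
    cs.simple_mul_simple_cancel_right]
  omega

/-- Every reflection exchanges two values `a < b`. -/
lemma exists_reflection_lt (h : IsAffineRep cs P) {t : W} (ht : cs.IsReflection t) :
    ∃ u i, t = u * cs.simple i * u⁻¹ ∧ P u ((i : ℕ) - 1) < P u (i : ℕ) := by
  obtain ⟨u, i, rfl⟩ := ht
  rcases lt_trichotomy (P u ((i : ℕ) - 1)) (P u (i : ℕ)) with hl | hl | hl
  · exact ⟨u, i, rfl, hl⟩
  · have := (P u).injective hl
    omega
  · refine ⟨u * cs.simple i, i, by simp [mul_assoc], ?_⟩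
    rw [h.mul_simple_apply, h.mul_simple_apply, adjSwap_of_dvd_succ h.two_le (by simp),
      adjSwap_of_dvd (by simp)]
    simpa using hl

theorem length_lt_reflection_mul_iff (h : IsAffineRep cs P) (u w : W) (i : Fin (n + 1))
    (hu : P u ((i : ℕ) - 1) < P u (i : ℕ)) :
    cs.length w < cs.length (u * cs.simple i * u⁻¹ * w) ↔
      P w⁻¹ (P u ((i : ℕ) - 1)) < P w⁻¹ (P u (i : ℕ)) := by
  constructor
  · intro hl
    by_contra hc
    rcases lt_or_eq_of_le (not_lt.1 hc) with h1 | h1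
    · exact lt_asymm hl (h.length_reflection_mul_lt u w i hu h1)
    · exact hu.ne' ((P w⁻¹).injective h1)
  · intro hl
    have h2 : ∀ m, P (u * cs.simple i * u⁻¹ * w)⁻¹ (P u m) =
        P w⁻¹ (P u (adjSwap (n + 1) (i : ℕ) m)) := fun m => by
      have : (u * cs.simple i * u⁻¹ * w)⁻¹ = w⁻¹ * (u * (cs.simple i * u⁻¹)) := by
        simp [mul_assoc]
      rw [this]
      simp only [map_mul, Equiv.Perm.mul_apply, h.simple]
      simp
    have h1 := h.length_reflection_mul_lt u (u * cs.simple i * u⁻¹ * w) i hu (by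
      rw [h2, h2, adjSwap_of_dvd (by simp), adjSwap_of_dvd_succ h.two_le (by simp)]
      simpa using hl)
    simpa [mul_assoc] using h1

end IsAffineRep

section Bruhat

variable {B : Type*} {W : Type*} [Group W] {M : CoxeterMatrix B} (cs : CoxeterSystem M W)

/-- An upward edge of the Bruhat graph. -/
def BruhatEdge (a b : W) : Prop :=
  (∃ t, cs.IsReflection t ∧ b = t * a) ∧ cs.length a < cs.length b

variable {cs}

lemma bruhatLE_iff_reflTransGen {a b : W} :
    bruhatLE cs a b ↔ Relation.ReflTransGen (BruhatEdge cs) a b := by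
  rw [Relation.reflTransGen_iff_eq_or_transGen, bruhatLE, eq_comm]
  rfl

lemma bruhatLE_refl (a : W) : bruhatLE cs a a := Or.inl rfl

lemma bruhatLE_trans {a b c : W} (h : bruhatLE cs a b) (h' : bruhatLE cs b c) :
    bruhatLE cs a c := by
  rw [bruhatLE_iff_reflTransGen] at *
  exact h.trans h'

lemma BruhatEdge.le {a b : W} (h : BruhatEdge cs a b) : bruhatLE cs a b :=
  bruhatLE_iff_reflTransGen.2 (.single h)

lemma bruhatEdge_mul_simple {a : W} {i : B} (h : cs.length a < cs.length (a * cs.simple i)) :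
    BruhatEdge cs a (a * cs.simple i) :=
  ⟨⟨_, ⟨a, i, rfl⟩, by simp⟩, h⟩

lemma bruhatLE_inv {a b : W} (h : bruhatLE cs a b) : bruhatLE cs a⁻¹ b⁻¹ := by
  rw [bruhatLE_iff_reflTransGen] at *
  refine Relation.ReflTransGen.lift (·⁻¹) ?_ _ _ h
  rintro a _ ⟨⟨t, ht, rfl⟩, hl⟩
  refine ⟨⟨a⁻¹ * t * a, ?_, ?_⟩, by simpa only [cs.length_inv] using hl⟩
  · simpa using ht.conj a⁻¹
  · simp [ht.inv]

end Bruhat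

namespace IsAffineRep

variable {n : ℕ} {W : Type*} [Group W] {M : CoxeterMatrix (Fin (n + 1))}
  {cs : CoxeterSystem M W} {P : W →* Equiv.Perm ℤ}

lemma edge_mul_simple (h : IsAffineRep cs P) {a b : W} (hab : BruhatEdge cs a b)
    (i : Fin (n + 1)) :
    bruhatLE cs (a * cs.simple i) b ∨ bruhatLE cs (a * cs.simple i) (b * cs.simple i) := by
  have hab' := hab
  obtain ⟨⟨t, ht, rfl⟩, hl⟩ := hab
  rcases cs.length_mul_simple a i with hi | hi
  · by_cases hc : cs.length (a * cs.simple i) < cs.length (t * (a * cs.simple i))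
    · right
      rw [mul_assoc]
      exact BruhatEdge.le ⟨⟨t, ht, rfl⟩, hc⟩
    · left
      obtain ⟨u, j, rfl, hu⟩ := h.exists_reflection_lt ht
      rw [h.length_lt_reflection_mul_iff u _ j hu] at hl hc
      rw [h.mul_simple_inv_apply, h.mul_simple_inv_apply] at hc
      obtain ⟨hd, he⟩ := dvd_of_adjSwap_lt h.two_le hl (lt_of_le_of_ne (not_lt.1 hc) fun heq => by
        have := congrArg (adjSwap (n + 1) (i : ℕ)) heq
        rw [adjSwap_adjSwap h.two_le, adjSwap_adjSwap h.two_le] at this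
        exact hl.ne' this)
      rw [h.conj_simple_eq u a j i hd he, inv_mul_cancel_right]
      exact bruhatLE_refl _
  · left
    refine bruhatLE_trans ?_ hab'.le
    have := bruhatEdge_mul_simple (cs := cs) (a := a * cs.simple i) (i := i) (by simp; omega)
    simpa using this.le

lemma mul_simple_le_or (h : IsAffineRep cs P) {a b : W} (hab : bruhatLE cs a b)
    (i : Fin (n + 1)) :
    bruhatLE cs (a * cs.simple i) b ∨ bruhatLE cs (a * cs.simple i) (b * cs.simple i) := by
  rw [bruhatLE_iff_reflTransGen] at hab
  induction hab using Relation.ReflTransGen.head_induction_on with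
  | refl => exact Or.inr (bruhatLE_refl _)
  | head hac hcb ih =>
    rcases h.edge_mul_simple hac i with h1 | h1
    · exact Or.inl (bruhatLE_trans h1 (bruhatLE_iff_reflTransGen.2 hcb))
    · exact ih.imp (bruhatLE_trans h1) (bruhatLE_trans h1)

lemma mul_simple_le (h : IsAffineRep cs P) {a b : W} (hab : bruhatLE cs a b) {i : Fin (n + 1)}
    (hb : cs.length b < cs.length (b * cs.simple i)) :
    bruhatLE cs (a * cs.simple i) (b * cs.simple i) :=
  (h.mul_simple_le_or hab i).elim (fun h1 => bruhatLE_trans h1 (bruhatEdge_mul_simple hb).le) id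

lemma simple_mul_le (h : IsAffineRep cs P) {a b : W} (hab : bruhatLE cs a b) {i : Fin (n + 1)}
    (hb : cs.length (cs.simple i * b) < cs.length b) : bruhatLE cs (cs.simple i * a) b := by
  have hb' : bruhatLE cs (b⁻¹ * cs.simple i) b⁻¹ := by
    have := bruhatEdge_mul_simple (cs := cs) (a := b⁻¹ * cs.simple i) (i := i) (by
      have h1 := cs.length_inv (cs.simple i * b)
      have h2 := cs.length_inv b
      rw [mul_inv_rev, cs.inv_simple] at h1
      rw [cs.simple_mul_simple_cancel_right]
      omega)
    simpa using this.le
  have h3 : bruhatLE cs (a⁻¹ * cs.simple i) b⁻¹ :=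
    (h.mul_simple_le_or (bruhatLE_inv hab) i).elim id fun h1 => bruhatLE_trans h1 hb'
  simpa using bruhatLE_inv h3

end IsAffineRep

lemma Int.ediv_eq_of_le_of_lt {a q N : ℤ} (hN : 0 < N) (h1 : q * N ≤ a) (h2 : a < (q + 1) * N) :
    a / N = q :=
  le_antisymm (Int.lt_add_one_iff.1 ((Int.ediv_lt_iff_lt_mul hN).2 h2))
    ((Int.le_ediv_iff_mul_le hN).2 h1)

lemma Int.sub_one_ediv {N : ℤ} (hN : 0 < N) (a : ℤ) :
    (a - 1) / N = a / N - if N ∣ a then 1 else 0 := by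
  have h1 := Int.emod_add_mul_ediv a N
  have h2 := Int.emod_nonneg a hN.ne'
  have h3 := Int.emod_lt_of_pos a hN
  split_ifs with hd
  · rw [Int.emod_eq_zero_of_dvd hd] at h1
    apply Int.ediv_eq_of_le_of_lt hN <;> nlinarith
  · have : a % N ≠ 0 := fun h => hd (Int.dvd_of_emod_eq_zero h)
    have : 1 ≤ a % N := by omega
    apply Int.ediv_eq_of_le_of_lt hN <;> nlinarith

/-- The residue of an integer modulo `n + 1`. -/
def residue (n : ℕ) (m : ℤ) : Fin (n + 1) :=
  ⟨(m % (n + 1)).toNat, by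
    have h1 := Int.emod_nonneg m (show (n + 1 : ℤ) ≠ 0 by omega)
    have h2 := Int.emod_lt_of_pos m (show (0 : ℤ) < n + 1 by omega)
    omega⟩

lemma coe_residue (n : ℕ) (m : ℤ) : ((residue n m : ℕ) : ℤ) = m % (n + 1) :=
  Int.toNat_of_nonneg (Int.emod_nonneg m (show (n + 1 : ℤ) ≠ 0 by omega))

lemma eq_residue_iff {n : ℕ} {r : Fin (n + 1)} {m : ℤ} :
    r = residue n m ↔ (n + 1 : ℤ) ∣ m - (r : ℕ) := by
  constructor
  · rintro rfl
    rw [coe_residue]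
    exact Int.dvd_self_sub_emod
  · intro h
    refine Fin.eq_of_dvd_sub ?_
    have h1 : (n + 1 : ℤ) ∣ m - (residue n m : ℕ) := by
      rw [coe_residue]
      exact Int.dvd_self_sub_emod
    have := dvd_sub h h1
    rwa [sub_sub_sub_cancel_left] at this

section Vertices

variable {n : ℕ} {W : Type*} [Group W]

/-- Up to a constant, the `r`-th coordinate of the `i`-th vertex of the alcove of `w`. -/
def vertexCoord (n : ℕ) (P : W →* Equiv.Perm ℤ) (w : W) (i r : ℤ) : ℤ :=
  (P w⁻¹ r - i) / (n + 1)

/-- The total amount by which the coordinates of the `i`-th vertex of the alcove of `w`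
exceed `k`. -/
def excess (n : ℕ) (P : W →* Equiv.Perm ℤ) (w : W) (i k : ℤ) : ℤ :=
  ∑ r : Fin (n + 1), max (vertexCoord n P w i (r : ℕ) - k) 0

end Vertices

namespace IsAffineRep

variable {n : ℕ} {W : Type*} [Group W] {M : CoxeterMatrix (Fin (n + 1))}
  {cs : CoxeterSystem M W} {P : W →* Equiv.Perm ℤ}

lemma vertexCoord_add_mul (h : IsAffineRep cs P) (w : W) (i m k : ℤ) :
    vertexCoord n P w i (m + k * (n + 1)) = vertexCoord n P w i m + k := by
  rw [vertexCoord, h.shift_mul, vertexCoord, add_sub_right_comm,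
    Int.add_mul_ediv_right _ _ (by omega)]

lemma apply_inv_apply (w : W) (m : ℤ) : P w⁻¹ (P w m) = m := by simp

lemma vertexCoord_add_one (h : IsAffineRep cs P) (w : W) (i : ℤ) (r : Fin (n + 1)) :
    vertexCoord n P w (i + 1) (r : ℕ) =
      vertexCoord n P w i (r : ℕ) - if r = residue n (P w i) then 1 else 0 := by
  have key : (n + 1 : ℤ) ∣ P w⁻¹ (r : ℕ) - i ↔ r = residue n (P w i) := by
    rw [eq_residue_iff]
    constructor
    · rintro ⟨l, hl⟩
      have h1 := h.shift_mul w⁻¹ (r : ℕ) (-l)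
      rw [show P w⁻¹ (r : ℕ) + -l * (n + 1) = i by linarith] at h1
      rw [← h1]
      simp
    · rintro ⟨l, hl⟩
      have h1 := h.shift_mul w⁻¹ (r : ℕ) l
      rw [show ((r : ℕ) : ℤ) + l * (n + 1) = P w i by linarith, apply_inv_apply] at h1
      exact ⟨-l, by linarith⟩
  rw [vertexCoord, ← sub_sub, Int.sub_one_ediv (by omega), vertexCoord]
  simp only [key]

lemma sum_vertexCoord_add_one (h : IsAffineRep cs P) (w : W) (i : ℤ) :
    ∑ r : Fin (n + 1), vertexCoord n P w (i + 1) (r : ℕ) =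
      ∑ r : Fin (n + 1), vertexCoord n P w i (r : ℕ) - 1 := by
  simp [h.vertexCoord_add_one, Finset.sum_sub_distrib]

lemma excess_add_one (h : IsAffineRep cs P) (w : W) (i k : ℤ) :
    excess n P w (i + 1) k =
      excess n P w i k - if P w i < -k * (n + 1) then 1 else 0 := by
  have h0 : vertexCoord n P w i (residue n (P w i) : ℕ) = -(P w i / (n + 1)) := by
    have h1 := h.vertexCoord_add_mul w i (residue n (P w i) : ℕ) (P w i / (n + 1))
    rw [coe_residue, mul_comm, Int.emod_add_mul_ediv] at h1
    rw [coe_residue]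
    have h2 : vertexCoord n P w i (P w i) = 0 := by simp [vertexCoord]
    omega
  have h1 : P w i < -k * (n + 1) ↔ k < -(P w i / (n + 1)) := by
    rw [lt_neg, Int.ediv_lt_iff_lt_mul (by omega)]
  have h2 : ∀ r : Fin (n + 1), max (vertexCoord n P w (i + 1) (r : ℕ) - k) 0 =
      max (vertexCoord n P w i (r : ℕ) - k) 0 -
        if r = residue n (P w i) then (if P w i < -k * (n + 1) then 1 else 0) else 0 := by
    intro r
    rw [h.vertexCoord_add_one]
    simp only [h1]
    split_ifs with h3 h4
    · subst h3
      rw [h0]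
      omega
    · subst h3
      rw [h0]
      omega
    · simp
  rw [excess, Finset.sum_congr rfl fun r _ => h2 r, Finset.sum_sub_distrib]
  simp [excess]

lemma vertexCoord_mul_simple (h : IsAffineRep cs P) (w : W) {i : ℤ} {j : Fin (n + 1)}
    (hij : ¬ (n + 1 : ℤ) ∣ i - (j : ℕ)) (r : ℤ) :
    vertexCoord n P (w * cs.simple j) i r = vertexCoord n P w i r := by
  rw [vertexCoord, vertexCoord, h.mul_simple_inv_apply]
  set m := P w⁻¹ r
  by_cases h1 : (n + 1 : ℤ) ∣ m - (j : ℕ)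
  · rw [adjSwap_of_dvd h1, sub_right_comm, Int.sub_one_ediv (by omega), if_neg, sub_zero]
    intro h2
    apply hij
    have := dvd_sub h1 h2
    rwa [sub_sub_sub_cancel_left] at this
  by_cases h2 : (n + 1 : ℤ) ∣ m + 1 - (j : ℕ)
  · rw [adjSwap_of_dvd_succ h.two_le h2]
    have := Int.sub_one_ediv (show (0 : ℤ) < n + 1 by omega) (m + 1 - i)
    rw [if_neg, sub_zero] at this
    · rw [← this]
      ring_nf
    · intro h3
      apply hij
      have := dvd_sub h2 h3
      rwa [sub_sub_sub_cancel_left] at this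
  · rw [adjSwap_of_not_dvd h1 h2]

lemma excess_mul_simple (h : IsAffineRep cs P) (w : W) {i : ℤ} {j : Fin (n + 1)}
    (hij : ¬ (n + 1 : ℤ) ∣ i - (j : ℕ)) (k : ℤ) :
    excess n P (w * cs.simple j) i k = excess n P w i k := by
  simp only [excess, h.vertexCoord_mul_simple w hij]

lemma sum_vertexCoord (h : IsAffineRep cs P) (w : W) (i : ℤ) :
    ∑ r : Fin (n + 1), vertexCoord n P w i (r : ℕ) =
      ∑ r : Fin (n + 1), vertexCoord n P 1 i (r : ℕ) := by
  revert i
  refine cs.simple_induction_right (p := fun w => ∀ i : ℤ,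
    ∑ r : Fin (n + 1), vertexCoord n P w i (r : ℕ) =
      ∑ r : Fin (n + 1), vertexCoord n P 1 i (r : ℕ)) w (fun _ => rfl) fun w j ih i => ?_
  by_cases hd : (n + 1 : ℤ) ∣ i - (j : ℕ)
  · have h1 : ¬ (n + 1 : ℤ) ∣ i - 1 - (j : ℕ) := by
      have := not_dvd_of_dvd_sub_one h.two_le hd
      rwa [sub_right_comm] at this
    rw [← sub_add_cancel i 1, h.sum_vertexCoord_add_one, h.sum_vertexCoord_add_one, ← ih]
    simp only [h.vertexCoord_mul_simple w h1]
  · rw [← ih]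
    simp only [h.vertexCoord_mul_simple w hd]

/-- The excess of the vertices grows along the Bruhat order. -/
lemma excess_le_of_edge (h : IsAffineRep cs P) {a b : W} (hab : BruhatEdge cs a b) (i k : ℤ) :
    excess n P a i k ≤ excess n P b i k := by
  obtain ⟨⟨t, ht, rfl⟩, hl⟩ := hab
  obtain ⟨u, j, rfl, hu⟩ := h.exists_reflection_lt ht
  rw [h.length_lt_reflection_mul_iff u _ j hu] at hl
  have hinv : ∀ m, P (u * cs.simple j * u⁻¹ * a)⁻¹ m =
      P a⁻¹ (P u (adjSwap (n + 1) (j : ℕ) (P u⁻¹ m))) := fun m => by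
    have : (u * cs.simple j * u⁻¹ * a)⁻¹ = a⁻¹ * (u * (cs.simple j * u⁻¹)) := by
      simp [mul_assoc]
    rw [this]
    simp only [map_mul, Equiv.Perm.mul_apply, h.simple]
  set b := u * cs.simple j * u⁻¹ * a
  set A := P u ((j : ℕ) - 1) with hA
  set B := P u (j : ℕ) with hB
  have hbA : vertexCoord n P b i A = vertexCoord n P a i B := by
    rw [vertexCoord, hinv, hA, apply_inv_apply, adjSwap_of_dvd_succ h.two_le (by simp),
      sub_add_cancel]
    rfl
  have hbB : vertexCoord n P b i B = vertexCoord n P a i A := by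
    rw [vertexCoord, hinv, hB, apply_inv_apply, adjSwap_of_dvd (by simp)]
    rfl
  have hres : ∀ m : ℤ, ((residue n m : ℕ) : ℤ) + m / (n + 1) * (n + 1) = m := fun m => by
    rw [coe_residue, mul_comm, Int.emod_add_mul_ediv]
  have hval : ∀ m : ℤ, ∀ w, vertexCoord n P w i (residue n m : ℕ) =
      vertexCoord n P w i m - m / (n + 1) := fun m w => by
    have := h.vertexCoord_add_mul w i (residue n m : ℕ) (m / (n + 1))
    rw [hres] at this
    omega
  have hdvd : ∀ m c : ℤ, (n + 1 : ℤ) ∣ P u m - c → (n + 1 : ℤ) ∣ m - P u⁻¹ c := by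
    rintro m c ⟨l, hl⟩
    have := h.shift_mul u⁻¹ c l
    rw [show c + l * (n + 1) = P u m by linarith, apply_inv_apply] at this
    exact ⟨l, by linarith⟩
  have hne : residue n A ≠ residue n B := by
    intro he
    rw [eq_residue_iff, coe_residue] at he
    have h1 : (n + 1 : ℤ) ∣ B - A := by
      have := dvd_sub he (Int.dvd_self_sub_emod (x := A) (m := (n + 1 : ℤ)))
      rwa [sub_sub_sub_cancel_right] at this
    have h2 := hdvd _ _ h1
    rw [hA, apply_inv_apply] at h2
    exact not_dvd_of_dvd_sub_one h.two_le h2 (by simp)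
  have hsame : ∀ r : Fin (n + 1), r ≠ residue n A ∧ r ≠ residue n B →
      max (vertexCoord n P b i (r : ℕ) - k) 0 - max (vertexCoord n P a i (r : ℕ) - k) 0 = 0 := by
    rintro r ⟨hrA, hrB⟩
    rw [Ne, eq_residue_iff] at hrA hrB
    have h1 : ∀ c : ℤ, ¬ (n + 1 : ℤ) ∣ P u c - (r : ℕ) → ¬ (n + 1 : ℤ) ∣ P u⁻¹ (r : ℕ) - c := by
      rintro c hc ⟨l, hl⟩
      apply hc
      have := h.shift_mul u c l
      rw [show c + l * (n + 1) = P u⁻¹ (r : ℕ) by linarith,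
        show P u (P u⁻¹ (r : ℕ)) = (r : ℕ) by simp] at this
      exact ⟨-l, by linarith⟩
    rw [vertexCoord, hinv, adjSwap_of_not_dvd (h1 _ hrB)]
    · simp [vertexCoord]
    · have := h1 _ hrA
      rwa [sub_sub_eq_add_sub] at this
  rw [← sub_nonneg, excess, excess, ← Finset.sum_sub_distrib,
    Fintype.sum_eq_add _ _ hne hsame, hval, hval, hval, hval, hbA, hbB]
  have h1 : A / (n + 1) ≤ B / (n + 1) := Int.ediv_le_ediv (by omega) hu.le
  have h2 : vertexCoord n P a i A ≤ vertexCoord n P a i B :=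
    Int.ediv_le_ediv (by omega) (by omega)
  omega

lemma excess_le_of_bruhatLE (h : IsAffineRep cs P) {a b : W} (hab : bruhatLE cs a b) (i k : ℤ) :
    excess n P a i k ≤ excess n P b i k := by
  rw [bruhatLE_iff_reflTransGen] at hab
  induction hab with
  | refl => exact le_rfl
  | tail _ hbc ih => exact ih.trans (h.excess_le_of_edge hbc i k)

end IsAffineRep

namespace IsAffineRep

variable {n : ℕ} {W : Type*} [Group W] {M : CoxeterMatrix (Fin (n + 1))}
  {cs : CoxeterSystem M W} {P : W →* Equiv.Perm ℤ}

lemma vertexCoord_apply (P : W →* Equiv.Perm ℤ) (w : W) (i m : ℤ) :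
    vertexCoord n P w i (P w m) = (m - i) / (n + 1) := by
  rw [vertexCoord, apply_inv_apply]

lemma vertexCoord_eq_residue (h : IsAffineRep cs P) (w : W) (i m : ℤ) :
    vertexCoord n P w i m = vertexCoord n P w i (residue n m : ℕ) + m / (n + 1) := by
  have := h.vertexCoord_add_mul w i (residue n m : ℕ) (m / (n + 1))
  rwa [coe_residue, mul_comm, Int.emod_add_mul_ediv, ← coe_residue] at this

/-- An element fixing the vertex `0` lies in the finite parabolic subgroup. -/
lemma exists_mul_eq_one (h : IsAffineRep cs P) (x : W)
    (hx : ∀ r : Fin (n + 1), vertexCoord n P x 0 (r : ℕ) = 0) :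
    ∃ w ∈ Submonoid.closure (cs.simple '' {i | i ≠ 0}), w * x = 1 := by
  induction hk : cs.length x using Nat.strong_induction_on generalizing x with
  | _ k ih =>
  subst hk
  rcases eq_or_ne x 1 with rfl | hne
  · exact ⟨1, one_mem _, one_mul _⟩
  obtain ⟨j, hj⟩ := cs.exists_rightDescent_of_ne_one hne
  have hj0 : j ≠ 0 := by
    rintro rfl
    refine lt_asymm hj ((h.length_lt_iff x 0 (m := 0) (by simp)).2 ?_)
    have h1 := h.vertexCoord_eq_residue x 0 (P x (0 - 1))
    have h2 := h.vertexCoord_eq_residue x 0 (P x 0)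
    rw [hx, vertexCoord_apply, zero_add] at h1 h2
    have h3 : (0 - 1 - 0 : ℤ) / (n + 1) = -1 :=
      Int.ediv_eq_of_le_of_lt (by omega) (by omega) (by omega)
    simp only [sub_self, Int.zero_ediv] at h2
    rw [h3] at h1
    by_contra hc
    have := Int.ediv_le_ediv (c := (n + 1 : ℤ)) (by omega) (not_lt.1 hc)
    omega
  have hd : ¬ (n + 1 : ℤ) ∣ 0 - (j : ℕ) := fun hd =>
    hj0 (Fin.eq_of_dvd_sub (by simpa using hd))
  obtain ⟨w, hw, hwx⟩ := ih _ hj (x * cs.simple j)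
    (fun r => by rw [h.vertexCoord_mul_simple x hd, hx]) rfl
  refine ⟨cs.simple j * w, mul_mem (Submonoid.subset_closure ⟨j, hj0, rfl⟩) hw, ?_⟩
  rw [← mul_assoc] at hwx
  rw [mul_assoc, eq_inv_of_mul_eq_one_left hwx]
  simp

lemma vertexCoord_eq_zero_of_excess_le (h : IsAffineRep cs P) (x : W)
    (hx : excess n P x 0 0 ≤ excess n P 1 0 0) (r : Fin (n + 1)) :
    vertexCoord n P x 0 (r : ℕ) = 0 := by
  have h1 : ∀ r : Fin (n + 1), vertexCoord n P 1 0 (r : ℕ) = 0 := fun r => by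
    have := r.isLt
    simp only [vertexCoord, inv_one, map_one, Equiv.Perm.one_apply, sub_zero]
    exact Int.ediv_eq_zero_of_lt (by omega) (by omega)
  have h2 := h.sum_vertexCoord x 0
  simp only [excess, h1, sub_zero, max_self, Finset.sum_const_zero] at hx h2
  have h3 : ∀ r : Fin (n + 1), vertexCoord n P x 0 (r : ℕ) ≤ 0 := fun r => by
    have h4 := Finset.single_le_sum (f := fun r : Fin (n + 1) =>
      max (vertexCoord n P x 0 (r : ℕ)) 0) (fun r _ => le_max_right _ _) (Finset.mem_univ r)
    exact (le_max_left _ _).trans (h4.trans hx)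
  exact (Finset.sum_eq_zero_iff_of_nonpos fun r _ => h3 r).1 h2 r (Finset.mem_univ r)

lemma excess_le_of_excess_le_mul_simple (h : IsAffineRep cs P) {x v : W} (j : Fin (n + 1))
    (hx : P x ((j : ℕ) - 1) < P x (j : ℕ))
    (hxv : ∀ i k, excess n P x i k ≤ excess n P (v * cs.simple j) i k) (i k : ℤ) :
    excess n P x i k ≤ excess n P v i k := by
  by_cases hd : (n + 1 : ℤ) ∣ i - (j : ℕ)
  · have hlt := h.lt_of_dvd x hd hx
    have hd1 : ¬ (n + 1 : ℤ) ∣ i - 1 - (j : ℕ) := by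
      have := not_dvd_of_dvd_sub_one h.two_le hd
      rwa [sub_right_comm] at this
    have hd2 : ¬ (n + 1 : ℤ) ∣ i + 1 - (j : ℕ) := fun h1 => by
      have := not_dvd_of_dvd_sub_one h.two_le h1
      rw [show i + 1 - ((j : ℕ) : ℤ) - 1 = i - (j : ℕ) by ring] at this
      exact this hd
    have h1 := hxv (i - 1) k
    have h2 := hxv i k
    have h3 := hxv (i + 1) k
    rw [h.excess_mul_simple v hd2, h.excess_add_one, h.excess_add_one] at h3
    rw [h.excess_mul_simple v hd1] at h1
    have e1 := h.excess_add_one x (i - 1) k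
    have e2 := h.excess_add_one v (i - 1) k
    have e3 := h.excess_add_one (v * cs.simple j) (i - 1) k
    rw [h.excess_mul_simple v hd1, h.mul_simple_apply,
      adjSwap_of_dvd_succ h.two_le (by simpa using hd)] at e3
    rw [sub_add_cancel] at e1 e2 e3
    rw [e3] at h2
    rw [e1] at h2 h3
    rw [e2] at h3
    rw [e1, e2]
    split_ifs at * <;> omega
  · have := hxv i k
    rwa [h.excess_mul_simple v hd] at this

theorem exists_mul_le_of_excess_le (h : IsAffineRep cs P) (x y : W)
    (hxy : ∀ i k, excess n P x i k ≤ excess n P y i k) :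
    ∃ w ∈ Submonoid.closure (cs.simple '' {i | i ≠ 0}), bruhatLE cs (w * x) y := by
  induction hk : cs.length y using Nat.strong_induction_on generalizing x y with
  | _ k ih =>
  subst hk
  rcases eq_or_ne y 1 with rfl | hne
  · obtain ⟨w, hw, hwx⟩ :=
      h.exists_mul_eq_one x (h.vertexCoord_eq_zero_of_excess_le x (hxy 0 0))
    exact ⟨w, hw, Or.inl hwx⟩
  obtain ⟨j, hj⟩ := cs.exists_rightDescent_of_ne_one hne
  obtain ⟨v, rfl⟩ : ∃ v, y = v * cs.simple j := ⟨y * cs.simple j, by simp⟩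
  rw [cs.isRightDescent_iff, cs.simple_mul_simple_cancel_right] at hj
  have hv : cs.length v < cs.length (v * cs.simple j) := by omega
  by_cases hx : P x ((j : ℕ) - 1) < P x (j : ℕ)
  · obtain ⟨w, hw, hwx⟩ := ih _ hv x v (h.excess_le_of_excess_le_mul_simple j hx hxy) rfl
    exact ⟨w, hw, bruhatLE_trans hwx (bruhatEdge_mul_simple hv).le⟩
  · rw [← h.length_lt_iff x j (by simp)] at hx
    have hlt : cs.length (x * cs.simple j) < cs.length (x * cs.simple j * cs.simple j) := by
      have := cs.length_mul_simple_ne x j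
      rw [cs.simple_mul_simple_cancel_right]
      omega
    have hle := h.excess_le_of_edge (bruhatEdge_mul_simple hlt)
    rw [cs.simple_mul_simple_cancel_right] at hle
    obtain ⟨w, hw, hwx⟩ := ih _ hv (x * cs.simple j) v
      (h.excess_le_of_excess_le_mul_simple j ((h.length_lt_iff _ j (by simp)).1 hlt)
        fun i k => (hle i k).trans (hxy i k)) rfl
    refine ⟨w, hw, ?_⟩
    have := h.mul_simple_le hwx hv
    rwa [← mul_assoc, cs.simple_mul_simple_cancel_right] at this

/-- The Bruhat order below an element with all finite left descents is detected by vertices. -/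
theorem bruhatLE_of_excess_le (h : IsAffineRep cs P) {x y : W}
    (hy : ∀ i : Fin (n + 1), i ≠ 0 → cs.length (cs.simple i * y) < cs.length y)
    (hxy : ∀ i k, excess n P x i k ≤ excess n P y i k) : bruhatLE cs x y := by
  have hinv : ∀ w ∈ Submonoid.closure (cs.simple '' {i | i ≠ 0}), ∀ a,
      bruhatLE cs (w * a) y → bruhatLE cs a y := by
    intro w hw
    induction hw using Submonoid.closure_induction with
    | mem w hw =>
      obtain ⟨i, hi, rfl⟩ := hw
      intro a ha
      simpa using h.simple_mul_le ha (hy i hi)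
    | one => simp
    | mul v w _ _ hv hw =>
      intro a ha
      rw [mul_assoc] at ha
      exact hw a (hv _ ha)
  obtain ⟨w, hw, hwx⟩ := h.exists_mul_le_of_excess_le x y hxy
  exact hinv w hw x hwx

/-- If the values `0, …, n` occur in decreasing order, then all finite simple reflections are left
descents. -/
lemma length_simple_mul_lt (h : IsAffineRep cs P) {y : W}
    (hy : ∀ r : Fin n, P y⁻¹ ((r : ℕ) + 1) < P y⁻¹ (r : ℕ)) {i : Fin (n + 1)} (hi : i ≠ 0) :
    cs.length (cs.simple i * y) < cs.length y := by
  obtain ⟨r, rfl⟩ := Fin.exists_succ_eq.2 hi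
  have := h.length_reflection_mul_lt 1 y r.succ (by simp) (by simpa using hy r)
  simpa using this

end IsAffineRep

section Majorization

variable {N : ℕ} {u v : Fin N → ℤ}

lemma sum_Iic_le_of_sum_max_le (hv : Antitone v)
    (h : ∀ k : ℤ, ∑ r, max (u r - k) 0 ≤ ∑ r, max (v r - k) 0) (j : Fin N) :
    ∑ r ∈ Finset.Iic j, u r ≤ ∑ r ∈ Finset.Iic j, v r := by
  suffices ∑ r ∈ Finset.Iic j, (u r - v j) ≤ ∑ r ∈ Finset.Iic j, (v r - v j) by
    simpa [Finset.sum_sub_distrib] using this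
  calc ∑ r ∈ Finset.Iic j, (u r - v j)
      ≤ ∑ r ∈ Finset.Iic j, max (u r - v j) 0 := Finset.sum_le_sum fun r _ => le_max_left _ _
    _ ≤ ∑ r, max (u r - v j) 0 :=
        Finset.sum_le_sum_of_subset_of_nonneg (Finset.subset_univ _) fun r _ _ => le_max_right _ _
    _ ≤ ∑ r, max (v r - v j) 0 := h _
    _ = ∑ r ∈ Finset.Iic j, max (v r - v j) 0 := by
        refine (Finset.sum_subset (Finset.subset_univ _) fun r _ hr => ?_).symm
        rw [Finset.mem_Iic, not_le] at hr
        exact max_eq_right (sub_nonpos.2 (hv hr.le))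
    _ = ∑ r ∈ Finset.Iic j, (v r - v j) :=
        Finset.sum_congr rfl fun r hr =>
          max_eq_left (sub_nonneg.2 (hv (Finset.mem_Iic.1 hr)))

lemma sum_max_le_of_sum_Iic_le (hu : Antitone u)
    (h : ∀ j, ∑ r ∈ Finset.Iic j, u r ≤ ∑ r ∈ Finset.Iic j, v r) (k : ℤ) :
    ∑ r, max (u r - k) 0 ≤ ∑ r, max (v r - k) 0 := by
  rcases (Finset.univ.filter fun r => k < u r).eq_empty_or_nonempty with hS | hS
  · refine (Finset.sum_nonpos fun r _ => ?_).trans (Finset.sum_nonneg fun r _ => le_max_right _ _)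
    have := Finset.filter_eq_empty_iff.1 hS (Finset.mem_univ r)
    exact max_le (by omega) le_rfl
  · set j := (Finset.univ.filter fun r => k < u r).max' hS
    have hj : k < u j := (Finset.mem_filter.1 (Finset.max'_mem _ hS)).2
    calc ∑ r, max (u r - k) 0 = ∑ r ∈ Finset.Iic j, max (u r - k) 0 := by
          refine (Finset.sum_subset (Finset.subset_univ _) fun r _ hr => ?_).symm
          by_contra hne
          refine hr (Finset.mem_Iic.2 (Finset.le_max' _ _ ?_))
          simp only [Finset.mem_filter, Finset.mem_univ, true_and]
          by_contra hk
          exact hne (max_eq_right (by omega))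
      _ = ∑ r ∈ Finset.Iic j, (u r - k) := by
          refine Finset.sum_congr rfl fun r hr => max_eq_left ?_
          have := hu (Finset.mem_Iic.1 hr)
          omega
      _ ≤ ∑ r ∈ Finset.Iic j, (v r - k) := by
          simpa [Finset.sum_sub_distrib] using h j
      _ ≤ ∑ r ∈ Finset.Iic j, max (v r - k) 0 := Finset.sum_le_sum fun r _ => le_max_left _ _
      _ ≤ ∑ r, max (v r - k) 0 :=
          Finset.sum_le_sum_of_subset_of_nonneg (Finset.subset_univ _)
            fun r _ _ => le_max_right _ _

end Majorization

section Cone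

variable {n : ℕ}

lemma inner_rootA (i : Fin n) (v : EuclideanSpace ℝ (Fin (n + 1))) :
    ⟪rootA i, v⟫ = v i.castSucc - v i.succ := by
  simp [rootA, inner_sub_left, EuclideanSpace.inner_single_left]

lemma sum_rootA (i : Fin n) : ∑ r, rootA i r = 0 := by
  simp [rootA, Finset.sum_sub_distrib]

lemma sum_Iic_rootA (i : Fin n) (j : Fin (n + 1)) :
    ∑ r ∈ Finset.Iic j, rootA i r = if i.castSucc = j then 1 else 0 := by
  simp only [rootA, PiLp.sub_apply, PiLp.single_apply, Finset.sum_sub_distrib,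
    Finset.sum_ite_eq', Finset.mem_Iic]
  simp only [Fin.le_def, Fin.ext_iff, Fin.val_castSucc, Fin.val_succ]
  split_ifs <;> first | omega | norm_num

lemma eq_of_sum_Iic_eq {a b : Fin (n + 1) → ℝ}
    (h : ∀ j, ∑ r ∈ Finset.Iic j, a r = ∑ r ∈ Finset.Iic j, b r) : a = b := by
  funext j
  induction j using Fin.induction with
  | zero =>
    have h0 : Finset.Iic (0 : Fin (n + 1)) = {0} := by ext; simp
    simpa [h0] using h 0
  | succ i _ =>
    have hi : Finset.Iic i.succ = insert i.succ (Finset.Iic i.castSucc) := by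
      ext r
      simp only [Finset.mem_Iic, Finset.mem_insert, Fin.le_def, Fin.ext_iff, Fin.val_castSucc,
        Fin.val_succ]
      omega
    have h1 := h i.succ
    rw [hi, Finset.sum_insert (by simp [Fin.le_def]), Finset.sum_insert (by simp [Fin.le_def]),
      h i.castSucc] at h1
    exact add_right_cancel h1

/-- Dominance order in terms of partial sums of coordinates. -/
lemma exists_mem_coneN_iff {a b : EuclideanSpace ℝ (Fin (n + 1))} :
    (∃ k ∈ coneN n, a = b + k) ↔
      ∑ r, b r = ∑ r, a r ∧
        ∀ j, ∑ r ∈ Finset.Iic j, b r ≤ ∑ r ∈ Finset.Iic j, a r := by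
  have key (c : Fin n → ℝ) (s : Finset (Fin (n + 1))) :
      ∑ r ∈ s, (∑ i, c i • rootA i : EuclideanSpace ℝ (Fin (n + 1))) r =
        ∑ i, c i * ∑ r ∈ s, rootA i r := by
    simp only [PiLp.smul_apply, smul_eq_mul, WithLp.ofLp_sum, Finset.sum_apply,
      Finset.mul_sum]
    exact Finset.sum_comm
  constructor
  · rintro ⟨_, ⟨c, hc, rfl⟩, rfl⟩
    refine ⟨?_, fun j => ?_⟩
    · simp only [PiLp.add_apply, Finset.sum_add_distrib, key, sum_rootA]
      simp
    · simp only [PiLp.add_apply, Finset.sum_add_distrib, key, sum_Iic_rootA]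
      refine le_add_of_nonneg_right (Finset.sum_nonneg fun i _ => mul_nonneg (hc i) ?_)
      split_ifs <;> norm_num
  · rintro ⟨h0, h1⟩
    refine ⟨_, ⟨fun i => ∑ r ∈ Finset.Iic i.castSucc, a r - ∑ r ∈ Finset.Iic i.castSucc, b r,
      fun i => sub_nonneg.2 (h1 _), rfl⟩, ?_⟩
    apply WithLp.ofLp_injective
    refine eq_of_sum_Iic_eq fun j => ?_
    simp only [PiLp.add_apply, Finset.sum_add_distrib, key, sum_Iic_rootA]
    rcases Fin.eq_castSucc_or_eq_last j with ⟨i, rfl⟩ | rfl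
    · simp
    · have hl : Finset.Iic (Fin.last n) = Finset.univ := by ext r; simp [Fin.le_last]
      simp [hl, h0, Fin.castSucc_ne_last]

end Cone

section Periodic

variable {n : ℕ}

lemma residue_coe (r : Fin (n + 1)) : residue n ((r : ℕ) : ℤ) = r :=
  (eq_residue_iff.2 (by simp)).symm

/-- The extension of a vector to a sequence `ℤ → ℝ` that grows by `1` over each period. -/
def periodicExt (v : EuclideanSpace ℝ (Fin (n + 1))) (m : ℤ) : ℝ :=
  v (residue n m) + ((m / (n + 1) : ℤ) : ℝ)

lemma residue_add_mul (m k : ℤ) : residue n (m + k * (n + 1)) = residue n m :=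
  (eq_residue_iff.2 (by
    rw [add_sub_right_comm]
    exact dvd_add (eq_residue_iff.1 rfl) (Dvd.intro_left k rfl))).symm

lemma periodicExt_add_mul (v : EuclideanSpace ℝ (Fin (n + 1))) (m k : ℤ) :
    periodicExt v (m + k * (n + 1)) = periodicExt v m + k := by
  rw [periodicExt, periodicExt, residue_add_mul, Int.add_mul_ediv_right _ _ (by omega)]
  push_cast
  ring

lemma periodicExt_coe (v : EuclideanSpace ℝ (Fin (n + 1))) (r : Fin (n + 1)) :
    periodicExt v (r : ℕ) = v r := by
  have h : ((r : ℕ) : ℤ) / (n + 1) = 0 := Int.ediv_eq_zero_of_lt (by omega) (by omega)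
  rw [periodicExt, residue_coe, h, Int.cast_zero, add_zero]

/-- The vector whose periodic extension is linear. -/
def linearVec (n : ℕ) : EuclideanSpace ℝ (Fin (n + 1)) :=
  WithLp.toLp 2 fun r => ((r : ℕ) : ℝ) / (n + 1)

lemma periodicExt_linearVec (m : ℤ) : periodicExt (linearVec n) m = m / (n + 1) := by
  have h : (((residue n m : ℕ) : ℤ) : ℝ) + (n + 1) * ((m / (n + 1) : ℤ) : ℝ) = m := by
    rw [coe_residue]
    exact_mod_cast Int.emod_add_mul_ediv m (n + 1)
  have hn : (n + 1 : ℝ) ≠ 0 := by positivity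
  rw [periodicExt, linearVec, ← h]
  push_cast
  field_simp

lemma periodicExt_linearVec_lt {m p : ℤ} :
    periodicExt (linearVec n) m < periodicExt (linearVec n) p ↔ m < p := by
  rw [periodicExt_linearVec, periodicExt_linearVec, div_lt_div_iff_of_pos_right (by positivity),
    Int.cast_lt]

lemma periodicExt_linearVec_injective : Function.Injective (periodicExt (linearVec n)) :=
  fun _ _ h => le_antisymm (not_lt.1 fun hl => (periodicExt_linearVec_lt.2 hl).ne' h)
    (not_lt.1 fun hl => (periodicExt_linearVec_lt.2 hl).ne h)

lemma periodicExt_adjSwap (hn : 1 ≤ n) {i : ℤ} {v v' : EuclideanSpace ℝ (Fin (n + 1))}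
    (h1 : periodicExt v' (i - 1) = periodicExt v i) (h2 : periodicExt v' i = periodicExt v (i - 1))
    (h3 : ∀ r : Fin (n + 1), ¬ (n + 1 : ℤ) ∣ (r : ℕ) - i → ¬ (n + 1 : ℤ) ∣ (r : ℕ) + 1 - i →
      v' r = v r) (m : ℤ) :
    periodicExt v' (adjSwap (n + 1) i m) = periodicExt v m := by
  by_cases hm : (n + 1 : ℤ) ∣ m - i
  · rw [adjSwap_of_dvd hm]
    obtain ⟨k, hk⟩ := hm
    obtain rfl : m = i + k * (n + 1) := by linarith
    rw [add_sub_right_comm, periodicExt_add_mul, periodicExt_add_mul, h1]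
  by_cases hm' : (n + 1 : ℤ) ∣ m + 1 - i
  · rw [adjSwap_of_dvd_succ (by omega) hm']
    obtain ⟨k, hk⟩ := hm'
    obtain rfl : m = i - 1 + k * (n + 1) := by linarith
    rw [add_right_comm, sub_add_cancel, periodicExt_add_mul, periodicExt_add_mul, h2]
  · have hr : (n + 1 : ℤ) ∣ m - (residue n m : ℕ) := eq_residue_iff.1 rfl
    rw [adjSwap_of_not_dvd hm hm', periodicExt, periodicExt, h3]
    · exact fun h => hm (by simpa using dvd_add hr h)
    · refine fun h => hm' ?_
      rw [← sub_add_sub_cancel _ ((residue n m : ℕ) + 1 : ℤ), add_sub_add_right_eq_sub]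
      exact dvd_add hr h

end Periodic

section Action

variable {n : ℕ} {W : Type*} [Group W] {M : CoxeterMatrix (Fin (n + 1))} {cs : CoxeterSystem M W}
  {act : W →* Equiv.Perm (EuclideanSpace ℝ (Fin (n + 1)))}

/-- `P` permutes the coordinates of periodic extensions in the way `act` acts on vectors. -/
def Intertwines (act : W →* Equiv.Perm (EuclideanSpace ℝ (Fin (n + 1))))
    (P : W → Equiv.Perm ℤ) : Prop :=
  ∀ w v m, periodicExt (act w v) (P w m) = periodicExt v m

lemma eq_of_periodicExt_act {w : W} {p q : ℤ}
    (h : ∀ v, periodicExt (act w v) p = periodicExt (act w v) q) : p = q := by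
  apply periodicExt_linearVec_injective (n := n)
  simpa using h ((act w).symm (linearVec n))

lemma periodicExt_act_simple (hn : 1 ≤ n)
    (hact0 : ∀ v, act (cs.simple 0) v = reflN (hiRoot n) (-1) v)
    (hacts : ∀ (i : Fin n) (v), act (cs.simple i.succ) v = reflN (rootA i) 0 v)
    (i : Fin (n + 1)) (v : EuclideanSpace ℝ (Fin (n + 1))) (m : ℤ) :
    periodicExt (act (cs.simple i) v) (adjSwap (n + 1) (i : ℕ) m) = periodicExt v m := by
  have hl : Fin.last n ≠ 0 := by simp [Fin.ext_iff]; omega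
  have h0 (u : EuclideanSpace ℝ (Fin (n + 1))) :
      periodicExt u ((((0 : Fin (n + 1)) : ℕ) : ℤ) - 1) = u (Fin.last n) - 1 := by
    have := periodicExt_add_mul u (Fin.last n : ℕ) (-1)
    rw [periodicExt_coe] at this
    convert this using 2
    · simp
    · simp [sub_eq_add_neg]
  have hs (u : EuclideanSpace ℝ (Fin (n + 1))) (j : Fin n) :
      periodicExt u (((j.succ : Fin (n + 1)) : ℕ) - 1 : ℤ) = u j.castSucc := by
    rw [← periodicExt_coe]
    simp
  refine periodicExt_adjSwap hn ?_ ?_ (fun r hr hr' => ?_) m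
  · cases i using Fin.cases with
    | zero =>
      rw [h0, periodicExt_coe, hact0]
      simp [reflN, hiRoot, inner_sub_left, EuclideanSpace.inner_single_left, hl]
      ring_nf
    | succ j =>
      rw [hs, periodicExt_coe, hacts]
      simp only [reflN, inner_rootA]
      simp [rootA, j.castSucc_lt_succ.ne]
  · cases i using Fin.cases with
    | zero =>
      rw [h0, periodicExt_coe, hact0]
      simp [reflN, hiRoot, inner_sub_left, EuclideanSpace.inner_single_left, hl.symm]
      ring_nf
    | succ j =>
      rw [hs, periodicExt_coe, hacts]
      simp only [reflN, inner_rootA]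
      simp [rootA, j.castSucc_lt_succ.ne']
  · cases i using Fin.cases with
    | zero =>
      have h1 : r ≠ 0 := by rintro rfl; simp at hr
      have h2 : r ≠ Fin.last n := by rintro rfl; simp at hr'
      rw [hact0]
      simp [reflN, hiRoot, h1, h2]
    | succ j =>
      have h1 : r ≠ j.castSucc := by rintro rfl; simp at hr'
      have h2 : r ≠ j.succ := by rintro rfl; simp at hr
      rw [hacts]
      simp [reflN, rootA, h1, h2]

theorem exists_isAffineRep (hn : 1 ≤ n)
    (hM : ∀ i j : Fin (n + 1), M i j =
      if i = j then 1 else if n = 1 then 0 else if j = i + 1 ∨ i = j + 1 then 3 else 2)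
    (hact0 : ∀ v, act (cs.simple 0) v = reflN (hiRoot n) (-1) v)
    (hacts : ∀ (i : Fin n) (v), act (cs.simple i.succ) v = reflN (rootA i) 0 v) :
    ∃ P : W →* Equiv.Perm ℤ, IsAffineRep cs P ∧ Intertwines act P := by
  have hex : ∀ w : W, ∃ σ : Equiv.Perm ℤ,
      ∀ v m, periodicExt (act w v) (σ m) = periodicExt v m := by
    intro w
    induction w using cs.simple_induction_left with
    | one => exact ⟨1, by simp⟩
    | mul_simple_left w i ih =>
    obtain ⟨σ, hσ⟩ := ih
    have hi := adjSwap_adjSwap (N := n + 1) (by omega) (i : ℕ)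
    refine ⟨(⟨_, _, hi, hi⟩ : Equiv.Perm ℤ) * σ, fun v m => ?_⟩
    rw [map_mul, Equiv.Perm.mul_apply, Equiv.Perm.mul_apply, ← hσ v m]
    exact periodicExt_act_simple hn hact0 hacts i _ _
  choose P hP using hex
  refine ⟨MonoidHom.mk' P fun a b => Equiv.ext fun m =>
    eq_of_periodicExt_act (act := act) (w := a * b) fun v => ?_, ⟨hn, hM, fun w m =>
      eq_of_periodicExt_act (act := act) (w := w) fun v => ?_, fun i m =>
      eq_of_periodicExt_act (act := act) (w := cs.simple i) fun v => ?_⟩, hP⟩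
  · rw [hP, map_mul, Equiv.Perm.mul_apply, Equiv.Perm.mul_apply, hP, hP]
  · have h1 := periodicExt_add_mul v m 1
    have h2 := periodicExt_add_mul (act w v) (P w m) 1
    rw [one_mul] at h1 h2
    rw [MonoidHom.mk'_apply, hP, h1, h2, hP]
  · rw [MonoidHom.mk'_apply, hP, periodicExt_act_simple hn hact0 hacts]

end Action

section Alcoves

variable {n : ℕ} {W : Type*} [Group W] {M : CoxeterMatrix (Fin (n + 1))} {cs : CoxeterSystem M W}
  {act : W →* Equiv.Perm (EuclideanSpace ℝ (Fin (n + 1)))} {P : W →* Equiv.Perm ℤ}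

lemma Intertwines.act_apply (hP : Intertwines act P) (w : W)
    (v : EuclideanSpace ℝ (Fin (n + 1))) (r : Fin (n + 1)) :
    act w v r = periodicExt v (P w⁻¹ (r : ℕ)) := by
  rw [← hP w, ← periodicExt_coe, ← Equiv.Perm.mul_apply, ← map_mul]
  simp

lemma mem_AplusN_iff {v : EuclideanSpace ℝ (Fin (n + 1))} :
    v ∈ AplusN n ↔ ∀ i j : Fin (n + 1), i < j → -1 < v i - v j ∧ v i - v j < 0 := by
  simp only [AplusN, PhiPosN, Set.mem_ofPred_eq]
  constructor
  · intro h i j hij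
    simpa [inner_sub_left, EuclideanSpace.inner_single_left] using h _ ⟨i, j, hij, rfl⟩
  · rintro h _ ⟨i, j, hij, rfl⟩
    simpa [inner_sub_left, EuclideanSpace.inner_single_left] using h i j hij

lemma linearVec_mem_AplusN : linearVec n ∈ AplusN n := by
  refine mem_AplusN_iff.2 fun i j hij => ?_
  have h1 : ((i : ℕ) : ℝ) < (j : ℕ) := by exact_mod_cast hij
  have h2 : ((j : ℕ) : ℝ) < n + 1 := by exact_mod_cast j.isLt
  have h3 : (0 : ℝ) ≤ (i : ℕ) := by positivity
  rw [linearVec, ← sub_div, lt_div_iff₀ (by positivity), div_lt_iff₀ (by positivity)]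
  constructor <;> linarith

lemma periodicExt_strictMono {v : EuclideanSpace ℝ (Fin (n + 1))} (hv : v ∈ AplusN n) :
    StrictMono (periodicExt v) := by
  rw [mem_AplusN_iff] at hv
  intro m p hmp
  have hm := Int.emod_add_mul_ediv m (n + 1)
  have hp := Int.emod_add_mul_ediv p (n + 1)
  rw [← coe_residue] at hm hp
  have hr := (residue n m).isLt
  have hs := (residue n p).isLt
  rw [periodicExt, periodicExt]
  rcases (Int.ediv_le_ediv (by omega) hmp.le : m / (n + 1 : ℤ) ≤ p / (n + 1)).eq_or_lt with h | h
  · rw [← h] at hp ⊢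
    have := hv (residue n m) (residue n p) (by rw [Fin.lt_def]; omega)
    linarith
  · have h' : ((m / (n + 1) : ℤ) : ℝ) + 1 ≤ ((p / (n + 1) : ℤ) : ℝ) := by exact_mod_cast h
    rcases lt_trichotomy (residue n m) (residue n p) with hl | hl | hl
    · have := hv _ _ hl
      linarith
    · rw [hl]
      linarith
    · have := hv _ _ hl
      linarith

lemma domN_iff (hP : Intertwines act P) (z : W) :
    DomN act z ↔ ∀ r : Fin n, P z⁻¹ ((r : ℕ) + 1) < P z⁻¹ (r : ℕ) := by
  have key (v : EuclideanSpace ℝ (Fin (n + 1))) (r : Fin n) : 0 < ⟪rootA r, act z v⟫ ↔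
      periodicExt v (P z⁻¹ ((r : ℕ) + 1)) < periodicExt v (P z⁻¹ (r : ℕ)) := by
    rw [inner_rootA, sub_pos, hP.act_apply, hP.act_apply]
    simp
  constructor
  · intro h r
    exact periodicExt_linearVec_lt.1
      ((key _ r).1 (h (Set.mem_image_of_mem _ linearVec_mem_AplusN) r))
  · rintro h _ ⟨v, hv, rfl⟩ r
    exact (key _ r).2 (periodicExt_strictMono hv (h r))

lemma antitone_vertexCoord {z : W} (hz : ∀ r : Fin n, P z⁻¹ ((r : ℕ) + 1) < P z⁻¹ (r : ℕ)) (i : ℤ) :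
    Antitone fun r : Fin (n + 1) => vertexCoord n P z i (r : ℕ) := by
  refine Fin.antitone_iff_succ_le.2 fun r => Int.ediv_le_ediv (by omega) ?_
  simpa using (hz r).le

lemma lt_of_antitone_vertexCoord {z : W}
    (hz : ∀ i : Fin (n + 1), Antitone fun r : Fin (n + 1) => vertexCoord n P z (i : ℕ) (r : ℕ))
    (r : Fin n) : P z⁻¹ ((r : ℕ) + 1) < P z⁻¹ (r : ℕ) := by
  by_contra hlt
  have hlt' : P z⁻¹ (r : ℕ) < P z⁻¹ ((r : ℕ) + 1) :=
    (not_lt.1 hlt).lt_of_ne fun h => by simpa using (P z⁻¹).injective h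
  have h1 := Fin.antitone_iff_succ_le.1 (hz (residue n (P z⁻¹ ((r : ℕ) + 1)))) r
  obtain ⟨q, hq⟩ := eq_residue_iff.1 (rfl : residue n (P z⁻¹ ((r : ℕ) + 1)) = _)
  simp only [vertexCoord, Fin.val_succ, Fin.val_castSucc, Nat.cast_add, Nat.cast_one] at h1
  rw [hq, Int.mul_ediv_cancel_left _ (by omega), Int.le_ediv_iff_mul_le (by omega),
    mul_comm, ← hq] at h1
  omega

lemma excess_add_mul (w : W) (i l k : ℤ) :
    excess n P w (i + l * (n + 1)) k = excess n P w i (k + l) := by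
  refine Finset.sum_congr rfl fun r _ => ?_
  rw [vertexCoord, vertexCoord, ← sub_sub, sub_eq_add_neg _ (l * _), ← neg_mul,
    Int.add_mul_ediv_right _ _ (by omega)]
  ring_nf

lemma exists_periodicExt_eq {i : Fin (n + 1)} {f : EuclideanSpace ℝ (Fin (n + 1))}
    (hf : ∀ r : Fin n, ⟪rootA r, f⟫ = if i = r.succ then 1 else 0) :
    ∃ c : ℝ, ∀ m : ℤ, periodicExt (-f) m = ((m - (i : ℕ)) / (n + 1) : ℤ) + c := by
  refine ⟨-f 0 - ((0 - (i : ℕ)) / (n + 1) : ℤ), fun m => ?_⟩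
  have key (r : Fin (n + 1)) : -f r = (((r : ℕ) - (i : ℕ)) / (n + 1) : ℤ) +
      (-f 0 - ((0 - (i : ℕ)) / (n + 1) : ℤ)) := by
    induction r using Fin.induction with
    | zero => simp
    | succ r ih =>
      have h1 := hf r
      rw [inner_rootA] at h1
      have h2 := Int.sub_one_ediv (N := n + 1) (by omega) ((r : ℕ) + 1 - (i : ℕ))
      have h3 : (n + 1 : ℤ) ∣ (r : ℕ) + 1 - (i : ℕ) ↔ i = r.succ := by
        constructor
        · exact fun h => Fin.eq_of_dvd_sub (by simpa using h)
        · rintro rfl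
          simp
      rw [sub_right_comm, add_sub_cancel_right] at h2
      simp only [h3] at h2
      rw [Fin.val_castSucc, h2] at ih
      rw [Fin.val_succ, Nat.cast_add, Nat.cast_one]
      push_cast at ih ⊢
      linarith
  have hm := Int.emod_add_mul_ediv m (n + 1)
  rw [← coe_residue] at hm
  have h1 : (m - (i : ℕ)) / (n + 1 : ℤ) =
      ((residue n m : ℕ) - (i : ℕ)) / (n + 1) + m / (n + 1) := by
    rw [← Int.add_mul_ediv_right _ _ (by omega)]
    congr 1
    linarith
  rw [periodicExt, PiLp.neg_apply, key, h1]
  push_cast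
  ring

namespace IsAffineRep

/-- Dominance order on the `i`-th vertices of the alcoves of `a` and `b`. -/
lemma exists_mem_coneN_act_iff (h : IsAffineRep cs P) (hP : Intertwines act P) {i : Fin (n + 1)}
    {f : EuclideanSpace ℝ (Fin (n + 1))}
    (hf : ∀ r : Fin n, ⟪rootA r, f⟫ = if i = r.succ then 1 else 0) (a b : W) :
    (∃ k ∈ coneN n, act b (-f) = act a (-f) + k) ↔
      ∀ j : Fin (n + 1), ∑ r ∈ Finset.Iic j, vertexCoord n P a (i : ℕ) (r : ℕ) ≤
        ∑ r ∈ Finset.Iic j, vertexCoord n P b (i : ℕ) (r : ℕ) := by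
  obtain ⟨c, hc⟩ := exists_periodicExt_eq hf
  have hs : ∀ w : W, ∀ s : Finset (Fin (n + 1)), ∑ r ∈ s, act w (-f) r =
      ((∑ r ∈ s, vertexCoord n P w (i : ℕ) (r : ℕ) : ℤ) : ℝ) + ∑ r ∈ s, c := by
    intro w s
    rw [Int.cast_sum, ← Finset.sum_add_distrib]
    exact Finset.sum_congr rfl fun r _ => by rw [hP.act_apply, hc, vertexCoord]
  rw [exists_mem_coneN_iff]
  simp only [hs, add_le_add_iff_right, Int.cast_le]
  rw [h.sum_vertexCoord a, h.sum_vertexCoord b]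
  simp

/-- On dominant elements, the Bruhat order is dominance order of all alcove vertices. -/
theorem bruhatLE_iff (h : IsAffineRep cs P) (hP : Intertwines act P)
    {f : Fin (n + 1) → EuclideanSpace ℝ (Fin (n + 1))}
    (hf : ∀ i, ∀ r : Fin n, ⟪rootA r, f i⟫ = if i = r.succ then 1 else 0) {a b : W}
    (ha : DomN act a) (hb : DomN act b) :
    bruhatLE cs a b ↔ ∀ i, ∃ k ∈ coneN n, act b (-f i) = act a (-f i) + k := by
  rw [domN_iff hP] at ha hb
  simp only [fun i => h.exists_mem_coneN_act_iff hP (hf i)]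
  constructor
  · intro hab i
    exact sum_Iic_le_of_sum_max_le (antitone_vertexCoord hb _)
      (h.excess_le_of_bruhatLE hab (i : ℕ))
  · intro hab
    refine h.bruhatLE_of_excess_le (fun i hi => h.length_simple_mul_lt hb hi) fun i k => ?_
    have hi := Int.emod_add_mul_ediv i (n + 1)
    rw [← coe_residue, mul_comm] at hi
    rw [← hi, excess_add_mul, excess_add_mul]
    exact sum_max_le_of_sum_Iic_le (antitone_vertexCoord ha _) (hab _) _

lemma domN_iff_inner_nonneg (hP : Intertwines act P)
    {f : Fin (n + 1) → EuclideanSpace ℝ (Fin (n + 1))}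
    (hf : ∀ i, ∀ r : Fin n, ⟪rootA r, f i⟫ = if i = r.succ then 1 else 0) (z : W) :
    DomN act z ↔ ∀ i, ∀ j : Fin n, 0 ≤ ⟪rootA j, act z (-f i)⟫ := by
  have key : ∀ i, (∀ j : Fin n, 0 ≤ ⟪rootA j, act z (-f i)⟫) ↔
      Antitone fun r : Fin (n + 1) => vertexCoord n P z (i : ℕ) (r : ℕ) := by
    intro i
    obtain ⟨c, hc⟩ := exists_periodicExt_eq (hf i)
    rw [Fin.antitone_iff_succ_le]
    refine forall_congr' fun j => ?_
    rw [inner_rootA, sub_nonneg, hP.act_apply, hP.act_apply, hc, hc, add_le_add_iff_right,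
      Int.cast_le, vertexCoord, vertexCoord]
  rw [domN_iff hP]
  simp only [key]
  exact ⟨fun h i => antitone_vertexCoord h _, lt_of_antitone_vertexCoord⟩

end IsAffineRep

end Alcoves

/-- in type `Ãₙ`, a dominant `z` lies in `[x, y]` iff each vertex
`z(-ϖᵢ)` of its alcove lies in the `i`-th parallelotope intersected with the closed
dominant chamber. -/
theorem statement18
    {n : ℕ} (hn : 1 ≤ n)
    {W : Type*} [Group W] {M : CoxeterMatrix (Fin (n + 1))} (cs : CoxeterSystem M W)
    (hM : ∀ i j : Fin (n + 1), M i j =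
      if i = j then 1 else if n = 1 then 0 else if j = i + 1 ∨ i = j + 1 then 3 else 2)
    (act : W →* Equiv.Perm (EuclideanSpace ℝ (Fin (n + 1))))
    (hact0 : ∀ v, act (cs.simple 0) v = reflN (hiRoot n) (-1) v)
    (hacts : ∀ (i : Fin n) (v), act (cs.simple i.succ) v = reflN (rootA i) 0 v)
    (fwt : Fin (n + 1) → EuclideanSpace ℝ (Fin (n + 1)))
    (hfwt0 : fwt 0 = 0)
    (hfwtsum : ∀ j, ∑ k, fwt j k = 0)
    (hfwt : ∀ i j : Fin n, ⟪rootA i, fwt j.succ⟫ = if i = j then 1 else 0)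
    (x y : W) (hx : DomN act x) (hy : DomN act y) (hxy : bruhatLE cs x y) :
    ∀ z : W,
      (DomN act z ∧ bruhatLE cs x z ∧ bruhatLE cs z y) ↔
        ∀ i : Fin (n + 1),
          (∃ k ∈ coneN n, act z (-(fwt i)) = act x (-(fwt i)) + k) ∧
          (∃ k ∈ coneN n, act z (-(fwt i)) = act y (-(fwt i)) - k) ∧
          (∀ j : Fin n, 0 ≤ ⟪rootA j, act z (-(fwt i))⟫) := by
  obtain ⟨P, hrep, hP⟩ := exists_isAffineRep hn hM hact0 hacts
  have hf : ∀ i, ∀ r : Fin n, ⟪rootA r, fwt i⟫ = if i = r.succ then 1 else 0 := by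
    intro i r
    cases i using Fin.cases with
    | zero => simp [hfwt0, (Fin.succ_ne_zero r).symm]
    | succ j => simp [hfwt, Fin.succ_inj, eq_comm]
  have hsub : ∀ i z, (∃ k ∈ coneN n, act z (-(fwt i)) = act y (-(fwt i)) - k) ↔
      ∃ k ∈ coneN n, act y (-(fwt i)) = act z (-(fwt i)) + k := by
    intro i z
    simp only [eq_sub_iff_add_eq, eq_comm]
  intro z
  simp only [hsub, forall_and]
  rw [← IsAffineRep.domN_iff_inner_nonneg hP hf]
  constructor
  · rintro ⟨hz, hxz, hzy⟩
    exact ⟨(hrep.bruhatLE_iff hP hf hx hz).1 hxz, (hrep.bruhatLE_iff hP hf hz hy).1 hzy, hz⟩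
  · rintro ⟨hxz, hzy, hz⟩
    exact ⟨hz, (hrep.bruhatLE_iff hP hf hx hz).2 hxz, (hrep.bruhatLE_iff hP hf hz hy).2 hzy⟩
end
end
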